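/- arXiv:math/0609749 — 3 statements merged into one kernel-verified Lean document; each statement's English description precedes it below -/
import Mathlib

section
/- Let r be a positive integer or r = ∞, let p_1, …, p_t be distinct prime numbers, and for each i let G_i be a finite abelian p_i-group. Then π_r(G_1 ⊕ G_2 ⊕ ⋯ ⊕ G_t) = π_r(G_1) · π_r(G_2) ⋯ π_r(G_t). -/
open scoped ENat

/-- A group-partition: a finite weakly descending (each factor embeds in the previous one)
sequence of nontrivial finite abelian groups, recording the sequence of isomorphism classes
`G₁ ⊇ G₂ ⊇ ⋯` of a decomposition `G = G₁ ⊕ G₂ ⊕ ⋯`. -/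
structure AbGroupPartition : Type 1 where
  len : ℕ
  factor : Fin len → Type
  [grp : ∀ j, AddCommGroup (factor j)]
  [fin : ∀ j, Finite (factor j)]
  nontriv : ∀ j, Nontrivial (factor j)
  mono : ∀ (j : ℕ) (h : j + 1 < len),
    ∃ f : factor ⟨j + 1, h⟩ →+ factor ⟨j, Nat.lt_of_succ_lt h⟩, Function.Injective f

attribute [instance] AbGroupPartition.grp AbGroupPartition.fin

/-- `P` is a group-partition of `G`, i.e. `G ≅ G₁ ⊕ ⋯ ⊕ G_len`. -/
def AbGroupPartition.IsPartitionOf (P : AbGroupPartition) (G : Type*) [AddCommGroup G] : Prop :=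
  Nonempty (G ≃+ ((j : Fin P.len) → P.factor j))

/-- Componentwise isomorphism of group-partitions (i.e. equality of the underlying
sequences of isomorphism classes). -/
def AbGroupPartition.Equiv (P Q : AbGroupPartition) : Prop :=
  ∃ h : P.len = Q.len, ∀ j : Fin P.len, Nonempty (P.factor j ≃+ Q.factor (Fin.cast h j))

/-- `π_r(G)`: the number of group-partitions of `G` with at most `r` factors
(`r = ⊤` meaning no restriction on the number of factors). -/
noncomputable def partitionCount (r : ℕ∞) (G : Type*) [AddCommGroup G] : ℕ :=
  Nat.card (Quot fun P Q : {P : AbGroupPartition // P.IsPartitionOf G ∧ (P.len : ℕ∞) ≤ r} =>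
    P.1.Equiv Q.1)

/-- `a_r(n) = ∑_{|G| = n} π_r(G)`: the number of isomorphism classes of pairs of
a finite abelian group of order `n` together with a group-partition of it with at most `r`
factors (`r = ⊤` meaning no restriction). -/
noncomputable def abelianCount (r : ℕ∞) (n : ℕ) : ℕ :=
  Nat.card (Quot fun P Q : {P : AbGroupPartition //
      (∏ j, Nat.card (P.factor j)) = n ∧ (P.len : ℕ∞) ≤ r} => P.1.Equiv Q.1)

section Quotients

/-- A map out of a product that preserves and reflects equivalence relations, and is surjective
up to equivalence, identifies the product of the quotients with the quotient of the target. -/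
theorem Nat.card_quot_eq_prod {ι : Type*} [Fintype ι] {α : ι → Type*} {β : Type*}
    {r : ∀ i, α i → α i → Prop} {s : β → β → Prop} (hr : ∀ i, Equivalence (r i))
    (hs : Equivalence s) (F : (∀ i, α i) → β)
    (hF : ∀ a b, s (F a) (F b) ↔ ∀ i, r i (a i) (b i)) (hsurj : ∀ b, ∃ a, s (F a) b) :
    Nat.card (Quot s) = ∏ i, Nat.card (Quot (r i)) := by
  rw [← Nat.card_pi]
  symm
  refine Nat.card_eq_of_bijective (fun q => Quot.mk s (F fun i => (q i).out)) ⟨?_, ?_⟩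
  · intro q q' h
    have h' := (hF _ _).1 ((hs.quot_mk_eq_iff _ _).1 h)
    funext i
    rw [← Quot.out_eq (q i), ← Quot.out_eq (q' i)]
    exact Quot.sound (h' i)
  · intro b
    induction b using Quot.ind with | _ b =>
    obtain ⟨a, ha⟩ := hsurj b
    refine ⟨fun i => Quot.mk _ (a i), Quot.sound (hs.trans ((hF _ _).2 fun i => ?_) ha)⟩
    exact ((hr i).quot_mk_eq_iff _ _).1 (Quot.out_eq _)

/-- A map that preserves and reflects equivalence relations and is surjective up to equivalence
induces a bijection of quotients. -/
theorem Nat.card_quot_eq {α β : Type*} {r : α → α → Prop} {s : β → β → Prop}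
    (hs : Equivalence s) (F : α → β) (hF : ∀ a b, s (F a) (F b) ↔ r a b)
    (hsurj : ∀ b, ∃ a, s (F a) b) : Nat.card (Quot r) = Nat.card (Quot s) := by
  have hr : Equivalence r :=
    ⟨fun a => (hF _ _).1 (hs.refl _), fun h => (hF _ _).1 (hs.symm ((hF _ _).2 h)),
      fun h h' => (hF _ _).1 (hs.trans ((hF _ _).2 h) ((hF _ _).2 h'))⟩
  refine Nat.card_eq_of_bijective (Quot.map F fun a b => (hF a b).2) ⟨?_, ?_⟩
  · intro q q' h
    induction q using Quot.ind with | _ a =>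
    induction q' using Quot.ind with | _ b =>
    exact Quot.sound ((hF _ _).1 ((hs.quot_mk_eq_iff _ _).1 h))
  · intro b
    induction b using Quot.ind with | _ b =>
    obtain ⟨a, ha⟩ := hsurj b
    exact ⟨Quot.mk _ a, Quot.sound ha⟩

end Quotients

section Products

/-- Interchange of the two indices in a product of groups. -/
def AddEquiv.piComm {ι κ : Type*} (A : ι → κ → Type*) [∀ i j, AddCommGroup (A i j)] :
    (∀ i j, A i j) ≃+ ∀ j i, A i j where
  __ := Equiv.piComm A
  map_add' _ _ := rfl

theorem eq_zero_of_coprime_nsmul {A : Type*} [AddCommGroup A] {m n : ℕ} (h : m.Coprime n) {x : A}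
    (hm : m • x = 0) (hn : n • x = 0) : x = 0 := by
  have := Nat.dvd_gcd (addOrderOf_dvd_of_nsmul_eq_zero hm) (addOrderOf_dvd_of_nsmul_eq_zero hn)
  rwa [h.gcd_eq_one, Nat.dvd_one, AddMonoid.addOrderOf_eq_one_iff] at this

variable {ι : Type*} {n : ι → ℕ} {A B : ι → Type*} [∀ i, AddCommGroup (A i)]
  [∀ i, AddCommGroup (B i)]

/-- An embedding between products of groups of pairwise coprime exponents embeds each factor. -/
theorem exists_injective_of_pi_of_coprime (hn : Pairwise (Function.onFun Nat.Coprime n))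
    (hA : ∀ i (x : A i), n i • x = 0) (hB : ∀ i (x : B i), n i • x = 0)
    (f : (∀ i, A i) →+ ∀ i, B i) (hf : Function.Injective f) (i : ι) :
    ∃ g : A i →+ B i, Function.Injective g := by
  classical
  refine ⟨(Pi.evalAddMonoidHom B i).comp (f.comp (AddMonoidHom.single A i)), ?_⟩
  rw [injective_iff_map_eq_zero]
  intro x hx
  have h : f (Pi.single i x) = 0 := by
    funext j
    obtain rfl | hj := eq_or_ne i j
    · exact hx
    · refine eq_zero_of_coprime_nsmul (hn hj) ?_ (hB j _)
      rw [← Pi.smul_apply, ← map_nsmul, ← Pi.single_smul, hA i x]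
      simp
  have h' := hf (h.trans (map_zero f).symm)
  simpa using congrFun h' i

theorem nonempty_addEquiv_of_subsingleton {A B : Type*} [AddCommGroup A] [AddCommGroup B]
    [Subsingleton A] [Subsingleton B] : Nonempty (A ≃+ B) :=
  ⟨{ toFun := 0
     invFun := 0
     left_inv := fun _ => Subsingleton.elim _ _
     right_inv := fun _ => Subsingleton.elim _ _
     map_add' := fun _ _ => Subsingleton.elim _ _ }⟩

theorem nonempty_addEquiv_of_injective {A B : Type*} [AddCommGroup A] [AddCommGroup B] [Finite A]
    (f : A →+ B) (hf : Function.Injective f) (g : B →+ A) (hg : Function.Injective g) :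
    Nonempty (A ≃+ B) := by
  have := Finite.of_injective g hg
  exact ⟨AddEquiv.ofBijective f (hf.bijective_of_nat_card_le (Nat.card_le_card_of_injective g hg))⟩

theorem nonempty_addEquiv_of_pi_of_coprime [∀ i, Finite (A i)]
    (hn : Pairwise (Function.onFun Nat.Coprime n))
    (hA : ∀ i (x : A i), n i • x = 0) (hB : ∀ i (x : B i), n i • x = 0)
    (e : (∀ i, A i) ≃+ ∀ i, B i) (i : ι) : Nonempty (A i ≃+ B i) := by
  obtain ⟨f, hf⟩ := exists_injective_of_pi_of_coprime hn hA hB e.toAddMonoidHom e.injective i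
  obtain ⟨g, hg⟩ :=
    exists_injective_of_pi_of_coprime hn hB hA e.symm.toAddMonoidHom e.symm.injective i
  exact nonempty_addEquiv_of_injective f hf g hg

/-- A group killed by a product of pairwise coprime integers is the product of its torsion
subgroups. -/
theorem nonempty_addEquiv_pi_torsionBy [Fintype ι] (hn : Pairwise (Function.onFun Nat.Coprime n))
    {T : Type*} [AddCommGroup T] (hT : ∀ x : T, (∏ i, n i) • x = 0) :
    Nonempty (T ≃+ ∀ i, AddSubgroup.torsionBy T (n i : ℤ)) := by
  classical
  have h := Submodule.torsionBy_isInternal (R := ℤ) (M := T) (S := Finset.univ)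
    (q := fun i => (n i : ℤ)) (fun i _ j _ hij => Nat.isCoprime_iff_coprime.2 (hn hij))
    fun x => by rw [← Nat.cast_prod, natCast_zsmul, hT]
  let reindex : (∀ i : {i : ι // i ∈ Finset.univ}, Submodule.torsionBy ℤ T (n i : ℤ)) ≃+
      ∀ i, AddSubgroup.torsionBy T (n i : ℤ) :=
    { toFun x i := x ⟨i, Finset.mem_univ i⟩
      invFun x i := x i
      map_add' _ _ := rfl }
  exact ⟨((AddEquiv.ofBijective _ h).symm.trans (DirectSum.addEquivProd _)).trans reindex⟩

end Products

/-- An infinite sequence of finite abelian groups, each embedding in the previous one. -/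
structure DescendingGroups : Type 1 where
  factor : ℕ → Type
  [grp : ∀ j, AddCommGroup (factor j)]
  [fin : ∀ j, Finite (factor j)]
  mono : ∀ j, ∃ f : factor (j + 1) →+ factor j, Function.Injective f

namespace DescendingGroups

attribute [instance] DescendingGroups.grp DescendingGroups.fin

/-- Termwise isomorphism. -/
def Iso (S T : DescendingGroups) : Prop := ∀ j, Nonempty (S.factor j ≃+ T.factor j)

/-- The sequence decomposes `G`, with at most `r` nontrivial terms. -/
def IsPartitionOf (r : ℕ∞) (G : Type*) [AddCommGroup G] (S : DescendingGroups) : Prop :=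
  Nonempty (G ≃+ ∀ j, S.factor j) ∧ ∀ j : ℕ, r ≤ j → Subsingleton (S.factor j)

theorem iso_equivalence : Equivalence Iso :=
  ⟨fun _ _ => ⟨AddEquiv.refl _⟩, fun h j => (h j).map AddEquiv.symm,
    fun h h' j => (h j).elim fun e => (h' j).map e.trans⟩

theorem subsingleton_of_le (S : DescendingGroups) {j k : ℕ} (h : j ≤ k)
    (hj : Subsingleton (S.factor j)) : Subsingleton (S.factor k) := by
  induction k, h using Nat.le_induction with
  | base => exact hj
  | succ k _ ih =>
    obtain ⟨f, hf⟩ := S.mono k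
    exact hf.subsingleton

/-- Termwise product. -/
def pi {ι : Type} [Finite ι] (S : ι → DescendingGroups) : DescendingGroups where
  factor j := ∀ i, (S i).factor j
  mono j := by
    choose f hf using fun i => (S i).mono j
    exact ⟨AddMonoidHom.piMap f, Function.Injective.piMap hf⟩

/-- Termwise `n`-torsion. -/
def torsion (T : DescendingGroups) (n : ℕ) : DescendingGroups where
  factor j := AddSubgroup.torsionBy (T.factor j) (n : ℤ)
  mono j := by
    obtain ⟨f, hf⟩ := T.mono j
    refine ⟨(f.comp (AddSubgroup.subtype _)).codRestrict (AddSubgroup.torsionBy _ (n : ℤ))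
      fun x => ?_, fun x y h => Subtype.ext (hf (congrArg Subtype.val h))⟩
    have hx : (n : ℤ) • (x : T.factor (j + 1)) = 0 := x.2
    change (n : ℤ) • f x = 0
    rw [← map_zsmul, hx, map_zero]

theorem IsPartitionOf.nsmul_eq_zero {r : ℕ∞} {G : Type*} [AddCommGroup G] {S : DescendingGroups}
    (h : S.IsPartitionOf r G) {n : ℕ} (hG : ∀ x : G, n • x = 0) (j : ℕ) (x : S.factor j) :
    n • x = 0 := by
  obtain ⟨⟨e⟩, -⟩ := h
  have := congrArg (fun y => e y j) (hG (e.symm (Pi.single j x)))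
  simpa using this

theorem card_quot_pi (r : ℕ∞) {ι : Type} [Fintype ι] (G : ι → Type) [∀ i, AddCommGroup (G i)]
    [∀ i, Finite (G i)] (hG : Pairwise (Function.onFun Nat.Coprime fun i => Nat.card (G i))) :
    Nat.card (Quot fun S T : {S : DescendingGroups // S.IsPartitionOf r (∀ i, G i)} =>
      S.1.Iso T.1) =
    ∏ i, Nat.card (Quot fun S T : {S : DescendingGroups // S.IsPartitionOf r (G i)} =>
      S.1.Iso T.1) := by
  have hkill : ∀ i (x : G i), Nat.card (G i) • x = 0 := fun _ _ => card_nsmul_eq_zero'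
  refine Nat.card_quot_eq_prod (fun i => iso_equivalence.comap Subtype.val)
    (iso_equivalence.comap Subtype.val) (fun S => ⟨pi fun i => (S i).1, ?_, ?_⟩) ?_ ?_
  · have e := fun i => (S i).2.1.some
    exact ⟨(AddEquiv.piCongrRight e).trans (AddEquiv.piComm _)⟩
  · intro j hj
    have := fun i => (S i).2.2 j hj
    exact Pi.instSubsingleton
  · intro S T
    refine ⟨fun h i j => ?_, fun h j => ⟨AddEquiv.piCongrRight fun i => (h i j).some⟩⟩
    obtain ⟨e⟩ := h j
    exact nonempty_addEquiv_of_pi_of_coprime (A := fun i => (S i).1.factor j)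
      (B := fun i => (T i).1.factor j) hG (fun i => (S i).2.nsmul_eq_zero (hkill i) j)
      (fun i => (T i).2.nsmul_eq_zero (hkill i) j) e i
  · rintro ⟨T, hT⟩
    have hTkill := hT.nsmul_eq_zero (n := ∏ i, Nat.card (G i)) fun x => by
      rw [← Nat.card_pi, card_nsmul_eq_zero']
    have e := fun j => (nonempty_addEquiv_pi_torsionBy hG (hTkill j)).some
    refine ⟨fun i => ⟨T.torsion (Nat.card (G i)), ?_, fun j hj => ?_⟩, fun j => ⟨(e j).symm⟩⟩
    · obtain ⟨e'⟩ := hT.1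
      refine nonempty_addEquiv_of_pi_of_coprime hG hkill (fun i x => ?_)
        ((e'.trans (AddEquiv.piCongrRight e)).trans (AddEquiv.piComm _)) i
      funext j
      exact AddSubgroup.torsionBy.nsmul (x j)
    · have := hT.2 j hj
      exact Subtype.val_injective.subsingleton

end DescendingGroups

namespace AbGroupPartition

/-- A product over the indices equal to `j` is the factor of index `j`. -/
def piFiberEquiv (P : AbGroupPartition) {j : ℕ} (h : j < P.len) :
    (∀ k : {k : Fin P.len // (k : ℕ) = j}, P.factor k) ≃+ P.factor ⟨j, h⟩ :=
  letI : Unique {k : Fin P.len // (k : ℕ) = j} :=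
    { default := ⟨⟨j, h⟩, rfl⟩
      uniq := fun k => Subtype.ext (Fin.ext k.2) }
  AddEquiv.piUnique fun k : {k : Fin P.len // (k : ℕ) = j} => P.factor k

theorem isEmpty_fiber (P : AbGroupPartition) {j : ℕ} (h : ¬ j < P.len) :
    IsEmpty {k : Fin P.len // (k : ℕ) = j} :=
  ⟨fun k => h (k.2 ▸ k.1.2)⟩

/-- Extension of a group-partition by trivial groups: the `j`-th term is a product over the at
most one index equal to `j`. -/
def extend (P : AbGroupPartition) : DescendingGroups where
  factor j := ∀ k : {k : Fin P.len // (k : ℕ) = j}, P.factor k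
  mono j := by
    by_cases h : j + 1 < P.len
    · obtain ⟨f, hf⟩ := P.mono j h
      exact ⟨((P.piFiberEquiv (Nat.lt_of_succ_lt h)).symm.toAddMonoidHom.comp f).comp
        (P.piFiberEquiv h).toAddMonoidHom,
        ((P.piFiberEquiv _).symm.injective.comp hf).comp (P.piFiberEquiv h).injective⟩
    · have := P.isEmpty_fiber h
      exact ⟨0, Function.injective_of_subsingleton _⟩

theorem subsingleton_extend_iff (P : AbGroupPartition) (j : ℕ) :
    Subsingleton (P.extend.factor j) ↔ P.len ≤ j := by
  constructor
  · intro hj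
    by_contra! h
    have := P.nontriv ⟨j, h⟩
    have : Subsingleton (P.factor ⟨j, h⟩) :=
      (P.piFiberEquiv h).symm.toEquiv.subsingleton_congr.2 hj
    exact not_subsingleton (P.factor ⟨j, h⟩) this
  · intro h
    have := P.isEmpty_fiber h.not_gt
    exact ⟨fun _ _ => funext isEmptyElim⟩

theorem extend_iso_iff (P Q : AbGroupPartition) : P.extend.Iso Q.extend ↔ P.Equiv Q := by
  constructor
  · intro h
    have hlen : P.len = Q.len := by
      refine eq_of_forall_ge_iff fun j => ?_
      rw [← subsingleton_extend_iff, ← subsingleton_extend_iff]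
      exact (h j).some.toEquiv.subsingleton_congr
    exact ⟨hlen, fun j => (h j).map fun e =>
      ((P.piFiberEquiv j.2).symm.trans e).trans (Q.piFiberEquiv (hlen ▸ j.2))⟩
  · rintro ⟨hlen, h⟩ j
    by_cases hj : j < P.len
    · exact (h ⟨j, hj⟩).map fun e =>
        ((P.piFiberEquiv hj).trans e).trans (Q.piFiberEquiv (hlen ▸ hj)).symm
    · have := (P.subsingleton_extend_iff j).2 (not_lt.1 hj)
      have := (Q.subsingleton_extend_iff j).2 (hlen ▸ not_lt.1 hj)
      exact nonempty_addEquiv_of_subsingleton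

/-- The product of the factors is unchanged by the extension. -/
def piExtendEquiv (P : AbGroupPartition) :
    (∀ j, P.factor j) ≃+ ∀ j, P.extend.factor j where
  toFun x _ k := x k
  invFun x j := x j ⟨j, rfl⟩
  left_inv _ := rfl
  right_inv x := by
    funext j ⟨k, hk⟩
    subst hk
    rfl
  map_add' _ _ := rfl

theorem extend_isPartitionOf_iff (P : AbGroupPartition) (r : ℕ∞) (G : Type*) [AddCommGroup G] :
    P.extend.IsPartitionOf r G ↔ P.IsPartitionOf G ∧ (P.len : ℕ∞) ≤ r := by
  refine and_congr ⟨fun ⟨e⟩ => ⟨e.trans P.piExtendEquiv.symm⟩,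
    fun ⟨e⟩ => ⟨e.trans P.piExtendEquiv⟩⟩ ?_
  simp only [subsingleton_extend_iff]
  refine ⟨fun h => ?_, fun h j hj => by exact_mod_cast h.trans hj⟩
  induction r using ENat.recTopCoe with
  | top => exact le_top
  | coe r => exact_mod_cast h r le_rfl

end AbGroupPartition

namespace DescendingGroups

theorem IsPartitionOf.exists_subsingleton {r : ℕ∞} {G : Type*} [AddCommGroup G] [Finite G]
    {T : DescendingGroups} (hT : T.IsPartitionOf r G) : ∃ j, Subsingleton (T.factor j) := by
  by_contra! h
  obtain ⟨⟨e⟩, -⟩ := hT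
  exact not_finite_iff_infinite.2 Pi.infinite_of_left (Finite.of_equiv G e.toEquiv)

theorem exists_extend_iso (T : DescendingGroups) (hT : ∃ j, Subsingleton (T.factor j)) :
    ∃ P : AbGroupPartition, P.extend.Iso T := by
  classical
  let P : AbGroupPartition :=
    { len := Nat.find hT
      factor := fun j => T.factor j
      nontriv := fun j => not_subsingleton_iff_nontrivial.1 (Nat.find_min hT j.2)
      mono := fun j _ => T.mono j }
  refine ⟨P, fun j => ?_⟩
  by_cases hj : j < P.len
  · exact ⟨P.piFiberEquiv hj⟩
  · have := (P.subsingleton_extend_iff j).2 (not_lt.1 hj)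
    have := T.subsingleton_of_le (not_lt.1 hj) (Nat.find_spec hT)
    exact nonempty_addEquiv_of_subsingleton

theorem IsPartitionOf.congr {r : ℕ∞} {G : Type*} [AddCommGroup G] {S T : DescendingGroups}
    (hT : T.IsPartitionOf r G) (h : S.Iso T) : S.IsPartitionOf r G := by
  have e := fun j => (h j).some
  refine ⟨hT.1.map fun e' => e'.trans (AddEquiv.piCongrRight e).symm, fun j hj => ?_⟩
  have := hT.2 j hj
  exact (e j).injective.subsingleton

end DescendingGroups

/-- Group-partitions may be counted as infinite descending sequences. -/
theorem partitionCount_eq_card_descendingGroups (r : ℕ∞) (G : Type*) [AddCommGroup G] [Finite G] :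
    partitionCount r G =
      Nat.card (Quot fun S T : {S : DescendingGroups // S.IsPartitionOf r G} => S.1.Iso T.1) := by
  refine Nat.card_quot_eq (DescendingGroups.iso_equivalence.comap Subtype.val)
    (fun P => ⟨P.1.extend, (P.1.extend_isPartitionOf_iff r G).2 P.2⟩)
    (fun P Q => P.1.extend_iso_iff Q.1) ?_
  rintro ⟨T, hT⟩
  obtain ⟨P, hP⟩ := T.exists_extend_iso hT.exists_subsingleton
  exact ⟨⟨P, (P.extend_isPartitionOf_iff r G).1 (hT.congr hP)⟩, hP⟩

/-- If `p₁, …, p_t` are distinct primes and `G_i` is a finite abelian `p_i`-group for each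
`i`, then `π_r(G₁ ⊕ ⋯ ⊕ G_t) = π_r(G₁) ⋯ π_r(G_t)`, for `r` a positive integer or `r = ⊤`. -/
theorem pi_directSum_of_distinct_primes (r : ℕ∞) (hr : r ≠ 0) (t : ℕ) (p : Fin t → ℕ)
    (hp : ∀ i, (p i).Prime) (hinj : Function.Injective p)
    (G : Fin t → Type) [∀ i, AddCommGroup (G i)] [∀ i, Finite (G i)]
    (hG : ∀ i, ∃ k : ℕ, Nat.card (G i) = p i ^ k) :
    partitionCount r ((i : Fin t) → G i) = ∏ i, partitionCount r (G i) := by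
  have hcop : Pairwise (Function.onFun Nat.Coprime fun i => Nat.card (G i)) := by
    intro i j hij
    obtain ⟨k, hk⟩ := hG i
    obtain ⟨l, hl⟩ := hG j
    simp only [Function.onFun, hk, hl]
    exact Nat.coprime_pow_primes k l (hp i) (hp j) (hinj.ne hij)
  simp only [partitionCount_eq_card_descendingGroups]
  exact DescendingGroups.card_quot_pi r G hcop
end

section
/- For every ε > 0 there exists a constant D_ε > 0 such that for all positive integers n and every positive integer r (and for r = ∞), a_r(n) ≤ a_∞(n) ≤ D_ε · n^ε. -/
open scoped ENat

/-- The `p`-adic valuation of the order of `p ^ i • G`. -/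
noncomputable def nsmulVal (p i : ℕ) (G : Type*) [AddCommGroup G] : ℕ :=
  padicValNat p (Nat.card (nsmulAddMonoidHom (p ^ i) : G →+ G).range)

/-- The subgroup of elements of `p ^ i • G` killed by `p`. -/
def socleLayer (p i : ℕ) (G : Type*) [AddCommGroup G] : AddSubgroup G :=
  (nsmulAddMonoidHom p : G →+ G).ker ⊓ (nsmulAddMonoidHom (p ^ i) : G →+ G).range

/-- The Ulm-type invariant of `G`: the number of cyclic factors of `p`-power order exceeding
`p ^ i`. -/
noncomputable def socleRank (p i : ℕ) (G : Type*) [AddCommGroup G] : ℕ :=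
  padicValNat p (Nat.card (socleLayer p i G))

theorem mem_socleLayer {p i : ℕ} {G : Type*} [AddCommGroup G] {x : G} :
    x ∈ socleLayer p i G ↔ p • x = 0 ∧ ∃ y, p ^ i • y = x := by
  simp [socleLayer, AddSubgroup.mem_inf, AddMonoidHom.mem_ker]

theorem card_range_eq_card_socleLayer_mul (p i : ℕ) (G : Type*) [AddCommGroup G] :
    Nat.card (nsmulAddMonoidHom (p ^ i) : G →+ G).range =
      Nat.card (socleLayer p i G) *
        Nat.card (nsmulAddMonoidHom (p ^ (i + 1)) : G →+ G).range := by
  set A := (nsmulAddMonoidHom (p ^ i) : G →+ G).range with hA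
  set f : A →+ G := (nsmulAddMonoidHom p : G →+ G).comp A.subtype with hf
  have hrange : f.range = (nsmulAddMonoidHom (p ^ (i + 1)) : G →+ G).range := by
    ext x
    constructor
    · rintro ⟨⟨_, ⟨y, rfl⟩⟩, rfl⟩
      exact ⟨y, by simp [hf, pow_succ', mul_nsmul']⟩
    · rintro ⟨y, rfl⟩
      exact ⟨⟨p ^ i • y, ⟨y, rfl⟩⟩, by simp [hf, pow_succ', mul_nsmul']⟩
  have hker : Nat.card f.ker = Nat.card (socleLayer p i G) := by
    refine Nat.card_congr
      ⟨fun x => ⟨x.1.1, ?_⟩, fun x => ⟨⟨x.1, ?_⟩, ?_⟩, fun x => rfl, fun x => rfl⟩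
    · exact mem_socleLayer.2 ⟨x.2, x.1.2⟩
    · exact (mem_socleLayer.1 x.2).2
    · exact (mem_socleLayer.1 x.2).1
  rw [← AddSubgroup.card_mul_index f.ker, AddSubgroup.index_ker, hrange, hker]

theorem nsmulVal_zero {p : ℕ} {G : Type*} [AddCommGroup G] :
    nsmulVal p 0 G = padicValNat p (Nat.card G) := by
  have : (nsmulAddMonoidHom (p ^ 0) : G →+ G).range = ⊤ :=
    eq_top_iff.2 fun x _ => ⟨x, by simp⟩
  rw [nsmulVal, this, AddSubgroup.card_top]

section

variable {p : ℕ} [hp : Fact p.Prime] {G : Type*} [AddCommGroup G] [Finite G]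

theorem nsmulVal_eq_add (i : ℕ) : nsmulVal p i G = socleRank p i G + nsmulVal p (i + 1) G := by
  rw [nsmulVal, card_range_eq_card_socleLayer_mul, padicValNat.mul Nat.card_pos.ne'
    Nat.card_pos.ne', socleRank, nsmulVal]

theorem socleRank_pos {i : ℕ} (h : nsmulVal p i G ≠ 0) : 0 < socleRank p i G := by
  have hdvd : p ∣ Nat.card (nsmulAddMonoidHom (p ^ i) : G →+ G).range := by
    by_contra hnd
    exact h (padicValNat.eq_zero_of_not_dvd hnd)
  obtain ⟨x, hx⟩ := exists_prime_addOrderOf_dvd_card' p hdvd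
  have hx' : addOrderOf (x : G) = p := by rw [AddSubgroup.addOrderOf_coe, hx]
  have hmem : (x : G) ∈ socleLayer p i G :=
    mem_socleLayer.2 ⟨addOrderOf_dvd_iff_nsmul_eq_zero.1 hx'.dvd, x.2⟩
  have : p ∣ Nat.card (socleLayer p i G) := by
    have := addOrderOf_dvd_natCard (⟨x, hmem⟩ : socleLayer p i G)
    rwa [← AddSubgroup.addOrderOf_coe, hx'] at this
  exact one_le_padicValNat_of_dvd Nat.card_pos.ne' this

theorem nsmulVal_le (i : ℕ) : nsmulVal p i G ≤ padicValNat p (Nat.card G) - i := by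
  induction i with
  | zero => simp [nsmulVal_zero]
  | succ i ih =>
    have h1 := nsmulVal_eq_add (p := p) (G := G) i
    by_cases h : nsmulVal p i G = 0
    · omega
    · have := socleRank_pos h
      omega

theorem sum_socleRank {N : ℕ} (hN : padicValNat p (Nat.card G) ≤ N) :
    ∑ i ∈ Finset.range N, socleRank p i G = padicValNat p (Nat.card G) := by
  have key : ∀ M, ∑ i ∈ Finset.range M, socleRank p i G + nsmulVal p M G =
      padicValNat p (Nat.card G) := by
    intro M
    induction M with
    | zero => simp [nsmulVal_zero]
    | succ M ih => rw [Finset.sum_range_succ, add_assoc, ← nsmulVal_eq_add, ih]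
  have := key N
  have := nsmulVal_le (p := p) (G := G) N
  omega

theorem socleRank_eq_zero {i : ℕ} (hi : padicValNat p (Nat.card G) ≤ i) :
    socleRank p i G = 0 := by
  have := nsmulVal_le (p := p) (G := G) i
  have := nsmulVal_eq_add (p := p) (G := G) i
  omega

theorem padicValNat_le_of_dvd {a b : ℕ} (hb : b ≠ 0) (h : a ∣ b) :
    padicValNat p a ≤ padicValNat p b :=
  (padicValNat_dvd_iff_le hb).1 (pow_padicValNat_dvd.trans h)

theorem socleRank_antitone : Antitone fun i => socleRank p i G := by
  refine antitone_nat_of_succ_le fun i => padicValNat_le_of_dvd Nat.card_pos.ne' ?_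
  refine AddSubgroup.card_dvd_of_le fun x hx => ?_
  obtain ⟨h, y, rfl⟩ := mem_socleLayer.1 hx
  exact mem_socleLayer.2 ⟨h, p • y, by rw [pow_succ, mul_nsmul']⟩

end

theorem socleRank_le_of_injective {p : ℕ} [Fact p.Prime] {G H : Type*} [AddCommGroup G]
    [AddCommGroup H] [Finite H] (f : G →+ H) (hf : Function.Injective f) (i : ℕ) :
    socleRank p i G ≤ socleRank p i H := by
  refine padicValNat_le_of_dvd Nat.card_pos.ne' ?_
  have hmap : ∀ x : socleLayer p i G, f x ∈ socleLayer p i H := by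
    rintro ⟨x, hx⟩
    obtain ⟨h, y, rfl⟩ := mem_socleLayer.1 hx
    exact mem_socleLayer.2 ⟨by rw [← map_nsmul, h, map_zero], f y, by rw [← map_nsmul]⟩
  refine AddSubgroup.card_dvd_of_injective
    ((f.comp (socleLayer p i G).subtype).codRestrict (socleLayer p i H) hmap) ?_
  intro x y hxy
  exact Subtype.ext (hf (congrArg Subtype.val hxy))

theorem socleRank_congr {p : ℕ} [Fact p.Prime] {G H : Type*} [AddCommGroup G]
    [AddCommGroup H] [Finite G] [Finite H] (e : G ≃+ H) (i : ℕ) : socleRank p i G = socleRank p i H :=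
  le_antisymm (socleRank_le_of_injective e.toAddMonoidHom e.injective i)
    (socleRank_le_of_injective e.symm.toAddMonoidHom e.symm.injective i)

theorem nsmulVal_pi {p : ℕ} [Fact p.Prime] (k : ℕ) {ι : Type*} [Fintype ι] (A : ι → Type*)
    [∀ i, AddCommGroup (A i)] [∀ i, Finite (A i)] :
    nsmulVal p k (∀ i, A i) = ∑ i, nsmulVal p k (A i) := by
  have hcard : Nat.card (nsmulAddMonoidHom (p ^ k) : (∀ i, A i) →+ ∀ i, A i).range =
      ∏ i, Nat.card (nsmulAddMonoidHom (p ^ k) : A i →+ A i).range := by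
    rw [← Nat.card_pi]
    refine Nat.card_congr ((Equiv.subtypeEquivRight fun x => ?_).trans
      (Equiv.subtypePiEquivPi (p := fun i y => y ∈ (nsmulAddMonoidHom (p ^ k) : A i →+ A i).range)))
    constructor
    · rintro ⟨y, rfl⟩ i
      exact ⟨y i, rfl⟩
    · intro h
      choose y hy using h
      exact ⟨y, funext hy⟩
  have hprod : ∀ s : Finset ι, padicValNat p
      (∏ i ∈ s, Nat.card (nsmulAddMonoidHom (p ^ k) : A i →+ A i).range) =
      ∑ i ∈ s, nsmulVal p k (A i) := by
    classical
    intro s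
    induction s using Finset.induction_on with
    | empty => simp
    | insert a s ha ih =>
      rw [Finset.prod_insert ha, Finset.sum_insert ha, padicValNat.mul Nat.card_pos.ne'
        (Finset.prod_ne_zero_iff.2 fun i _ => Nat.card_pos.ne'), ih, nsmulVal]
  rw [nsmulVal, hcard, hprod]

theorem nsmulVal_zmod {p q : ℕ} [hp : Fact p.Prime] (hq : q.Prime) (e k : ℕ) :
    nsmulVal p k (ZMod (q ^ e)) = if q = p then e - k else 0 := by
  have : NeZero (q ^ e) := ⟨pow_ne_zero _ hq.ne_zero⟩
  rw [nsmulVal, IsAddCyclic.card_nsmulAddMonoidHom_range, Nat.card_zmod]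
  split_ifs with h
  · subst h
    rcases le_total e k with hek | hek
    · rw [Nat.gcd_eq_left (pow_dvd_pow _ hek), Nat.div_self (pow_pos hq.pos _)]
      simp [hek]
    · rw [Nat.gcd_eq_right (pow_dvd_pow _ hek), Nat.pow_div hek hq.pos, padicValNat.prime_pow]
  · rw [Nat.Coprime.gcd_eq_one (((Nat.coprime_primes hq hp.out).2 h).pow _ _), Nat.div_one]
    have : Fact q.Prime := ⟨hq⟩
    rw [padicValNat.pow, padicValNat_primes (Ne.symm h), mul_zero]

/-- Discarding trivial factors from a product. -/
theorem nonempty_addEquiv_pi_subtype {ι : Type*} (A : ι → Type*) [∀ i, AddCommGroup (A i)]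
    (P : ι → Prop) (h : ∀ i, ¬ P i → Subsingleton (A i)) :
    Nonempty ((∀ i, A i) ≃+ ∀ i : {i // P i}, A i) := by
  classical
  refine ⟨AddEquiv.ofBijective
    ({ toFun := fun x i => x i, map_zero' := rfl, map_add' := fun _ _ => rfl } :
      (∀ i, A i) →+ ∀ i : {i // P i}, A i) ⟨fun x y hxy => funext fun i => ?_, fun y => ?_⟩⟩
  · by_cases hi : P i
    · exact congrFun hxy ⟨i, hi⟩
    · have := h i hi
      exact Subsingleton.elim _ _
  · exact ⟨fun i => if hi : P i then y ⟨i, hi⟩ else 0, funext fun i => by simp [i.2]⟩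

theorem nsmulVal_add_card_eq {p : ℕ} [Fact p.Prime] {ι : Type*} [Fintype ι]
    {q : ι → ℕ} (hq : ∀ i, (q i).Prime) (e : ι → ℕ) (k : ℕ) :
    nsmulVal p k (∀ i, ZMod (q i ^ e i)) + nsmulVal p (k + 2) (∀ i, ZMod (q i ^ e i)) =
      2 * nsmulVal p (k + 1) (∀ i, ZMod (q i ^ e i)) +
        Nat.card {i // q i = p ∧ e i = k + 1} := by
  classical
  have : ∀ i, NeZero (q i ^ e i) := fun i => ⟨pow_ne_zero _ (hq i).ne_zero⟩
  rw [Nat.card_eq_fintype_card, Fintype.card_subtype, Finset.card_filter]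
  simp only [nsmulVal_pi, Finset.mul_sum, ← Finset.sum_add_distrib]
  refine Finset.sum_congr rfl fun i _ => ?_
  simp only [nsmulVal_zmod (hq i)]
  split_ifs <;> omega

theorem nsmulVal_eq_of_socleRank_eq {p : ℕ} [Fact p.Prime] {G H : Type*} [AddCommGroup G]
    [AddCommGroup H] [Finite G] [Finite H]
    (h : ∀ i, socleRank p i G = socleRank p i H) (i : ℕ) : nsmulVal p i G = nsmulVal p i H := by
  have hcard : padicValNat p (Nat.card G) = padicValNat p (Nat.card H) := by
    exact (sum_socleRank (le_max_left _ (padicValNat p (Nat.card H)))).symm.trans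
      ((Finset.sum_congr rfl fun i _ => h i).trans (sum_socleRank (le_max_right _ _)))
  induction i with
  | zero => rw [nsmulVal_zero, nsmulVal_zero, hcard]
  | succ i ih =>
    have h1 := nsmulVal_eq_add (p := p) (G := G) i
    have h2 := nsmulVal_eq_add (p := p) (G := H) i
    have := h i
    omega

theorem nsmulVal_congr {p : ℕ} [Fact p.Prime] {G H : Type*} [AddCommGroup G]
    [AddCommGroup H] [Finite G] [Finite H] (e : G ≃+ H) (i : ℕ) :
    nsmulVal p i G = nsmulVal p i H :=
  nsmulVal_eq_of_socleRank_eq (socleRank_congr e) i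

/-- Finite abelian groups are determined by their socle ranks. -/
theorem nonempty_addEquiv_of_socleRank_eq {G H : Type*} [AddCommGroup G] [AddCommGroup H]
    [Finite G] [Finite H]
    (h : ∀ p : ℕ, p.Prime → ∀ i, socleRank p i G = socleRank p i H) : Nonempty (G ≃+ H) := by
  classical
  obtain ⟨ι, _, q, hq, e, ⟨f⟩⟩ := AddCommGroup.equiv_directSum_zmod_of_finite G
  obtain ⟨κ, _, r, hr, d, ⟨g⟩⟩ := AddCommGroup.equiv_directSum_zmod_of_finite H
  have hne : ∀ i, NeZero (q i ^ e i) := fun i => ⟨pow_ne_zero _ (hq i).ne_zero⟩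
  have hne' : ∀ i, NeZero (r i ^ d i) := fun i => ⟨pow_ne_zero _ (hr i).ne_zero⟩
  let f' := f.trans (DirectSum.addEquivProd _)
  let g' := g.trans (DirectSum.addEquivProd _)
  have hcount : ∀ p : ℕ, p.Prime → ∀ k, Nat.card {i // q i = p ∧ e i = k + 1} =
      Nat.card {i // r i = p ∧ d i = k + 1} := by
    intro p hp k
    have : Fact p.Prime := ⟨hp⟩
    have h1 := nsmulVal_add_card_eq (p := p) hq e k
    have h2 := nsmulVal_add_card_eq (p := p) hr d k
    simp only [← nsmulVal_congr f', ← nsmulVal_congr g',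
      nsmulVal_eq_of_socleRank_eq (h p hp)] at h1 h2
    omega
  have hfib : ∀ c : ℕ × ℕ, Nonempty ({i : {i // e i ≠ 0} // (q i, e i) = c} ≃
      {i : {i // d i ≠ 0} // (r i, d i) = c}) := by
    rintro ⟨p, k⟩
    by_cases hpk : p.Prime ∧ k ≠ 0
    · obtain ⟨hp, hk⟩ := hpk
      obtain ⟨k, rfl⟩ := Nat.exists_eq_succ_of_ne_zero hk
      refine ⟨(Equiv.trans ?_ (Fintype.equivOfCardEq
        (by simpa only [Nat.card_eq_fintype_card] using hcount p hp k))).trans ?_⟩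
      · exact ⟨fun i => ⟨i.1.1, Prod.ext_iff.1 i.2⟩, fun i => ⟨⟨i.1, by have := i.2.2; omega⟩,
          Prod.ext_iff.2 i.2⟩, fun _ => rfl, fun _ => rfl⟩
      · exact ⟨fun i => ⟨⟨i.1, by have := i.2.2; omega⟩, Prod.ext_iff.2 i.2⟩,
          fun i => ⟨i.1.1, Prod.ext_iff.1 i.2⟩, fun _ => rfl, fun _ => rfl⟩
    · have h1 : IsEmpty {i : {i // e i ≠ 0} // (q i, e i) = (p, k)} := by
        refine ⟨fun i => hpk ?_⟩
        obtain ⟨h1, h2⟩ := Prod.mk.inj i.2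
        exact ⟨h1 ▸ hq _, h2 ▸ i.1.2⟩
      have h2 : IsEmpty {i : {i // d i ≠ 0} // (r i, d i) = (p, k)} := by
        refine ⟨fun i => hpk ?_⟩
        obtain ⟨h1, h2⟩ := Prod.mk.inj i.2
        exact ⟨h1 ▸ hr _, h2 ▸ i.1.2⟩
      exact ⟨Equiv.equivOfIsEmpty _ _⟩
  let E := Equiv.ofFiberEquiv (f := fun i : {i // e i ≠ 0} => (q i, e i))
    (g := fun i : {i // d i ≠ 0} => (r i, d i)) fun c => (hfib c).some
  have hE : ∀ i, (r (E i), d (E i)) = (q i, e i) := fun i => Equiv.ofFiberEquiv_map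
    (f := fun i : {i // e i ≠ 0} => (q i, e i)) (g := fun i : {i // d i ≠ 0} => (r i, d i))
    (fun c => (hfib c).some) i
  obtain ⟨u⟩ := nonempty_addEquiv_pi_subtype (fun i => ZMod (q i ^ e i)) (fun i => e i ≠ 0)
    fun i hi => by
      rw [not_not] at hi
      rw [hi, pow_zero]
      infer_instance
  obtain ⟨v⟩ := nonempty_addEquiv_pi_subtype (fun i => ZMod (r i ^ d i)) (fun i => d i ≠ 0)
    fun i hi => by
      rw [not_not] at hi
      rw [hi, pow_zero]
      infer_instance
  have hpow : ∀ i, r (E i) ^ d (E i) = q i ^ e i := fun i => by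
    rw [(Prod.mk.inj (hE i)).1, (Prod.mk.inj (hE i)).2]
  let w : (∀ i : {i // e i ≠ 0}, ZMod (q i ^ e i)) ≃+ ∀ i : {i // e i ≠ 0},
      ZMod (r (E i) ^ d (E i)) :=
    AddEquiv.piCongrRight fun i => (ZMod.ringEquivCongr (hpow i).symm).toAddEquiv
  let t : (∀ i : {i // d i ≠ 0}, ZMod (r i ^ d i)) ≃+ ∀ i : {i // e i ≠ 0},
      ZMod (r (E i) ^ d (E i)) :=
    { (Equiv.piCongrLeft (fun i : {i // d i ≠ 0} => ZMod (r i ^ d i)) E).symm with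
      map_add' := fun _ _ => rfl }
  exact ⟨((f'.trans u).trans w).trans ((g'.trans v).trans t).symm⟩

/-- Plane partitions of `k`, as three-dimensional Ferrers diagrams with `k` cells. -/
def SolidDiagram (k : ℕ) : Type :=
  {D : Finset (ℕ × ℕ × ℕ) // IsLowerSet (D : Set (ℕ × ℕ × ℕ)) ∧ D.card = k}

theorem Finset.mem_iff_lt_card_of_isLowerSet {S : Finset ℕ} (hS : IsLowerSet (S : Set ℕ)) {a : ℕ} :
    a ∈ S ↔ a < S.card := by
  constructor
  · intro ha
    have : Finset.range (a + 1) ⊆ S := fun b hb =>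
      hS (Nat.lt_succ_iff.1 (Finset.mem_range.1 hb)) ha
    simpa using Finset.card_le_card this
  · intro ha
    by_contra hn
    have : S ⊆ Finset.range a := fun b hb =>
      Finset.mem_range.2 (lt_of_not_ge fun hab => hn (hS hab hb))
    have := Finset.card_le_card this
    rw [Finset.card_range] at this
    omega

namespace SolidDiagram

variable {k : ℕ}

/-- The length of a line of a diagram, parametrised by `g`. -/
noncomputable def lineLength (D : SolidDiagram k) (g : ℕ → ℕ × ℕ × ℕ)
    (hg : Function.Injective g) : Fin (k + 1) :=
  ⟨(D.1.preimage g hg.injOn).card, Nat.lt_succ_of_le <| by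
    rw [← Finset.card_image_of_injective _ hg]
    exact (Finset.card_le_card (Finset.image_subset_iff.2 fun _ h => Finset.mem_preimage.1 h)).trans
      D.2.2.le⟩

theorem mem_iff_lt_lineLength (D : SolidDiagram k) {g : ℕ → ℕ × ℕ × ℕ}
    (hg : Function.Injective g) (hmono : Monotone g) (a : ℕ) :
    g a ∈ D.1 ↔ a < (D.lineLength g hg : ℕ) := by
  rw [lineLength, ← Finset.mem_iff_lt_card_of_isLowerSet, Finset.mem_preimage]
  intro x y hyx hx
  rw [Finset.mem_coe, Finset.mem_preimage] at hx ⊢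
  exact D.2.1 (hmono hyx) hx

theorem volume_le (D : SolidDiagram k) {a b c : ℕ} (h : (a, b, c) ∈ D.1) :
    (a + 1) * ((b + 1) * (c + 1)) ≤ k := by
  have : Finset.range (a + 1) ×ˢ Finset.range (b + 1) ×ˢ Finset.range (c + 1) ⊆ D.1 := by
    rintro ⟨x, y, z⟩ hx
    simp only [Finset.mem_product, Finset.mem_range, Nat.lt_succ_iff] at hx
    exact D.2.1 (show (x, y, z) ≤ (a, b, c) from ⟨hx.1, hx.2.1, hx.2.2⟩) h
  have := Finset.card_le_card this
  rwa [Finset.card_product, Finset.card_product, Finset.card_range, Finset.card_range,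
    Finset.card_range, D.2.2] at this

theorem injective_fst_line (b c : ℕ) : Function.Injective fun a : ℕ => (a, b, c) :=
  fun _ _ h => (Prod.mk.inj h).1

theorem injective_snd_line (a c : ℕ) : Function.Injective fun b : ℕ => (a, b, c) :=
  fun _ _ h => (Prod.mk.inj (Prod.mk.inj h).2).1

theorem injective_trd_line (a b : ℕ) : Function.Injective fun c : ℕ => (a, b, c) :=
  fun _ _ h => (Prod.mk.inj (Prod.mk.inj h).2).2

theorem monotone_fst_line (b c : ℕ) : Monotone fun a : ℕ => (a, b, c) :=
  fun _ _ h => ⟨h, le_rfl, le_rfl⟩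

theorem monotone_snd_line (a c : ℕ) : Monotone fun b : ℕ => (a, b, c) :=
  fun _ _ h => ⟨le_rfl, h, le_rfl⟩

theorem monotone_trd_line (a b : ℕ) : Monotone fun c : ℕ => (a, b, c) :=
  fun _ _ h => ⟨le_rfl, le_rfl, h⟩

/-- Base points of the lines used to encode a diagram. -/
def linePoints (S T : ℕ) : Finset (ℕ × ℕ) :=
  Finset.range S ×ˢ Finset.range T ∪ Finset.range T ×ˢ Finset.range S

theorem mem_linePoints {S T s t : ℕ} :
    (s, t) ∈ linePoints S T ↔ (s < S ∧ t < T) ∨ (s < T ∧ t < S) := by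
  simp [linePoints]

theorem card_linePoints_le (S T : ℕ) : (linePoints S T).card ≤ 2 * (S * T) := by
  refine (Finset.card_union_le _ _).trans ?_
  rw [Finset.card_product, Finset.card_product, Finset.card_range, Finset.card_range]
  exact le_of_eq (by ring)

/-- The lengths of all lines of a diagram through the points `linePoints S T` of the coordinate
planes. -/
noncomputable def code (S T : ℕ) (D : SolidDiagram k) :
    (linePoints S T → Fin (k + 1)) × (linePoints S T → Fin (k + 1)) ×
      (linePoints S T → Fin (k + 1)) :=
  (fun q => D.lineLength _ (injective_fst_line q.1.1 q.1.2),
    fun q => D.lineLength _ (injective_snd_line q.1.1 q.1.2),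
    fun q => D.lineLength _ (injective_trd_line q.1.1 q.1.2))

theorem exists_linePoint (D : SolidDiagram k) {S T : ℕ} (hS : k < (S + 1) ^ 3)
    (hT : k < (T + 1) ^ 2) {a b c : ℕ} (h : (a, b, c) ∈ D.1) :
    (b, c) ∈ linePoints S T ∨ (a, c) ∈ linePoints S T ∨ (a, b) ∈ linePoints S T := by
  have hv := D.volume_le h
  have h1 : a < S ∨ b < S ∨ c < S := by
    by_contra! hn
    have : (S + 1) * ((S + 1) * (S + 1)) ≤ (a + 1) * ((b + 1) * (c + 1)) := by
      gcongr <;> omega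
    nlinarith
  have h2 : a < T ∨ b < T := by
    by_contra! hn
    have : (T + 1) * ((T + 1) * 1) ≤ (a + 1) * ((b + 1) * (c + 1)) := by
      gcongr <;> omega
    nlinarith
  have h3 : a < T ∨ c < T := by
    by_contra! hn
    have : (T + 1) * (1 * (T + 1)) ≤ (a + 1) * ((b + 1) * (c + 1)) := by
      gcongr <;> omega
    nlinarith
  have h4 : b < T ∨ c < T := by
    by_contra! hn
    have : 1 * ((T + 1) * (T + 1)) ≤ (a + 1) * ((b + 1) * (c + 1)) := by
      gcongr <;> omega
    nlinarith
  simp only [mem_linePoints]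
  tauto

theorem code_injective {S T : ℕ} (hS : k < (S + 1) ^ 3) (hT : k < (T + 1) ^ 2) :
    Function.Injective (code (k := k) S T) := by
  have key : ∀ D D' : SolidDiagram k, D.code S T = D'.code S T → D.1 ⊆ D'.1 := by
    rintro D D' h ⟨a, b, c⟩ hD
    obtain ⟨h1, h23⟩ := Prod.mk.inj h
    obtain ⟨h2, h3⟩ := Prod.mk.inj h23
    rcases D.exists_linePoint hS hT hD with hq | hq | hq
    · have := congrFun h1 ⟨_, hq⟩
      have hD := (D.mem_iff_lt_lineLength (injective_fst_line b c) (monotone_fst_line b c) a).1 hD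
      rw [this] at hD
      exact (D'.mem_iff_lt_lineLength (injective_fst_line b c) (monotone_fst_line b c) a).2 hD
    · have := congrFun h2 ⟨_, hq⟩
      have hD := (D.mem_iff_lt_lineLength (injective_snd_line a c) (monotone_snd_line a c) b).1 hD
      rw [this] at hD
      exact (D'.mem_iff_lt_lineLength (injective_snd_line a c) (monotone_snd_line a c) b).2 hD
    · have := congrFun h3 ⟨_, hq⟩
      have hD := (D.mem_iff_lt_lineLength (injective_trd_line a b) (monotone_trd_line a b) c).1 hD
      rw [this] at hD
      exact (D'.mem_iff_lt_lineLength (injective_trd_line a b) (monotone_trd_line a b) c).2 hD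
  exact fun D D' h => Subtype.ext ((key D D' h).antisymm (key D' D h.symm))

theorem lt_floor_rpow_add_one_pow (k : ℕ) {m : ℕ} (hm : m ≠ 0) :
    k < (⌊(k : ℝ) ^ (m : ℝ)⁻¹⌋₊ + 1) ^ m := by
  have h := pow_lt_pow_left₀ (Nat.lt_floor_add_one ((k : ℝ) ^ (m : ℝ)⁻¹)) (by positivity) hm
  rw [Real.rpow_inv_natCast_pow (by positivity) hm] at h
  exact_mod_cast h

instance : Finite (SolidDiagram k) :=
  Finite.of_injective _
    (code_injective (lt_floor_rpow_add_one_pow k three_ne_zero)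
      (lt_floor_rpow_add_one_pow k two_ne_zero))

theorem card_le_pow {S T : ℕ} (hS : k < (S + 1) ^ 3) (hT : k < (T + 1) ^ 2) :
    Nat.card (SolidDiagram k) ≤ (k + 1) ^ (6 * (S * T)) := by
  refine (Nat.card_le_card_of_injective _ (code_injective hS hT)).trans ?_
  rw [Nat.card_prod, Nat.card_prod, Nat.card_fun, Nat.card_fin, Nat.card_eq_fintype_card,
    Fintype.card_coe, ← pow_add, ← pow_add]
  have := card_linePoints_le S T
  exact Nat.pow_le_pow_right k.succ_pos (by omega)

theorem card_le_exp (k : ℕ) : (Nat.card (SolidDiagram k) : ℝ) ≤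
    Real.exp (6 * (k : ℝ) ^ (5 / 6 : ℝ) * Real.log (k + 1)) := by
  have h := card_le_pow (lt_floor_rpow_add_one_pow k three_ne_zero)
    (lt_floor_rpow_add_one_pow k two_ne_zero)
  refine (Nat.cast_le.2 h).trans ?_
  have hk : (0 : ℝ) < k + 1 := by positivity
  rw [mul_comm (6 * (k : ℝ) ^ (5 / 6 : ℝ)), Real.exp_mul, Real.exp_log hk]
  push_cast
  rw [← Real.rpow_natCast]
  refine Real.rpow_le_rpow_of_exponent_le (by simp) ?_
  push_cast
  have h3 := Nat.floor_le (Real.rpow_nonneg (Nat.cast_nonneg (α := ℝ) k) (3 : ℝ)⁻¹)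
  have h2 := Nat.floor_le (Real.rpow_nonneg (Nat.cast_nonneg (α := ℝ) k) (2 : ℝ)⁻¹)
  have h6 : (k : ℝ) ^ (5 / 6 : ℝ) = (k : ℝ) ^ (3 : ℝ)⁻¹ * (k : ℝ) ^ (2 : ℝ)⁻¹ := by
    rw [← Real.rpow_add_of_nonneg (by positivity) (by norm_num) (by norm_num)]
    norm_num
  rw [h6]
  gcongr

theorem eventually_card_le_exp {δ : ℝ} (hδ : 0 < δ) :
    ∀ᶠ k : ℕ in Filter.atTop, (Nat.card (SolidDiagram k) : ℝ) ≤ Real.exp (δ * k) := by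
  have h := (isLittleO_log_rpow_atTop (r := 1 / 6) (by norm_num)).bound
    (show 0 < δ / 12 by positivity)
  have h' := (Filter.tendsto_atTop_add_const_right _ (1 : ℝ)
    tendsto_natCast_atTop_atTop).eventually h
  filter_upwards [h', Filter.eventually_ge_atTop 1] with k hk hk1
  refine (card_le_exp k).trans (Real.exp_le_exp.2 ?_)
  have hk1' : (1 : ℝ) ≤ k := by exact_mod_cast hk1
  have hlog : Real.log (k + 1) ≤ δ / 12 * ((k : ℝ) + 1) ^ (1 / 6 : ℝ) := by
    refine (le_abs_self _).trans ?_
    rwa [Real.norm_eq_abs, Real.norm_of_nonneg (by positivity)] at hk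
  calc 6 * (k : ℝ) ^ (5 / 6 : ℝ) * Real.log (k + 1)
      ≤ 6 * ((k : ℝ) + 1) ^ (5 / 6 : ℝ) * (δ / 12 * ((k : ℝ) + 1) ^ (1 / 6 : ℝ)) := by
        have := Real.log_nonneg (show (1 : ℝ) ≤ k + 1 by linarith)
        gcongr
        linarith
    _ = δ / 2 * (((k : ℝ) + 1) ^ (5 / 6 : ℝ) * ((k : ℝ) + 1) ^ (1 / 6 : ℝ)) := by ring
    _ = δ / 2 * (k + 1) := by
        rw [← Real.rpow_add (by positivity)]
        norm_num
    _ ≤ δ * k := by nlinarith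

theorem exists_card_le_mul_exp {δ : ℝ} (hδ : 0 < δ) :
    ∃ C : ℝ, 1 ≤ C ∧ ∀ k : ℕ, (Nat.card (SolidDiagram k) : ℝ) ≤ C * Real.exp (δ * k) := by
  obtain ⟨K, hK⟩ := Filter.eventually_atTop.1 (eventually_card_le_exp hδ)
  have hnn : 0 ≤ ∑ k ∈ Finset.range K, (Nat.card (SolidDiagram k) : ℝ) :=
    Finset.sum_nonneg fun _ _ => Nat.cast_nonneg _
  refine ⟨1 + ∑ k ∈ Finset.range K, (Nat.card (SolidDiagram k) : ℝ), by linarith, fun k => ?_⟩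
  have h1 : 1 ≤ Real.exp (δ * k) := Real.one_le_exp (by positivity)
  rcases lt_or_ge k K with hk | hk
  · have := Finset.single_le_sum (f := fun k => (Nat.card (SolidDiagram k) : ℝ))
      (fun _ _ => Nat.cast_nonneg _) (Finset.mem_range.2 hk)
    nlinarith
  · have := hK k hk
    nlinarith

theorem card_zero_le : Nat.card (SolidDiagram 0) ≤ 1 := by
  have : Subsingleton (SolidDiagram 0) :=
    ⟨fun D D' => Subtype.ext
      ((Finset.card_eq_zero.1 D.2.2).trans (Finset.card_eq_zero.1 D'.2.2).symm)⟩
  exact Finite.card_le_one_iff_subsingleton.2 this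

end SolidDiagram

/-- Multiplicativity turns the subexponential bound into an `n ^ ε` bound. -/
theorem exists_prod_card_solidDiagram_le {ε : ℝ} (hε : 0 < ε) :
    ∃ D : ℝ, 0 < D ∧ ∀ n : ℕ, 0 < n →
      ∏ p ∈ n.primeFactors, (Nat.card (SolidDiagram (n.factorization p)) : ℝ) ≤
        D * (n : ℝ) ^ ε := by
  obtain ⟨C, hC1, hC⟩ := SolidDiagram.exists_card_le_mul_exp
    (show 0 < ε * Real.log 2 from mul_pos hε (Real.log_pos one_lt_two))
  obtain ⟨B, hB1, hB⟩ := SolidDiagram.exists_card_le_mul_exp one_pos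
  obtain ⟨M, hM⟩ := Filter.eventually_atTop.1
    ((tendsto_rpow_atTop hε).comp tendsto_natCast_atTop_atTop |>.eventually_ge_atTop
      (B * Real.exp 1))
  have hlocal : ∀ p v : ℕ, p.Prime → (Nat.card (SolidDiagram v) : ℝ) ≤
      (if p < M then C else 1) * ((p : ℝ) ^ v) ^ ε := by
    intro p v hp
    have hp0 : (0 : ℝ) ≤ p := by positivity
    rw [← Real.rpow_natCast, ← Real.rpow_mul hp0, mul_comm (v : ℝ), Real.rpow_mul hp0,
      Real.rpow_natCast]
    split_ifs with hpM
    · refine (hC v).trans ?_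
      rw [mul_comm (ε * Real.log 2), Real.exp_nat_mul, mul_comm ε, Real.exp_mul,
        Real.exp_log two_pos]
      have : (2 : ℝ) ≤ p := by exact_mod_cast hp.two_le
      gcongr
    · rcases Nat.eq_zero_or_pos v with rfl | hv
      · simpa using SolidDiagram.card_zero_le
      · calc (Nat.card (SolidDiagram v) : ℝ) ≤ B * Real.exp (1 * v) := hB v
          _ = B ^ 1 * Real.exp 1 ^ v := by rw [one_mul, pow_one, ← Real.exp_nat_mul, mul_one]
          _ ≤ B ^ v * Real.exp 1 ^ v := by gcongr; exact hv
          _ = (B * Real.exp 1) ^ v := (mul_pow _ _ _).symm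
          _ ≤ ((p : ℝ) ^ ε) ^ v := by
            gcongr
            exact hM p (not_lt.1 hpM)
          _ = 1 * ((p : ℝ) ^ ε) ^ v := (one_mul _).symm
  refine ⟨C ^ M, by positivity, fun n hn => ?_⟩
  calc ∏ p ∈ n.primeFactors, (Nat.card (SolidDiagram (n.factorization p)) : ℝ)
      ≤ ∏ p ∈ n.primeFactors,
          ((if p < M then C else 1) * ((p : ℝ) ^ n.factorization p) ^ ε) :=
        Finset.prod_le_prod (fun _ _ => Nat.cast_nonneg _)
          fun p hp => hlocal p _ (Nat.prime_of_mem_primeFactors hp)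
    _ = C ^ (n.primeFactors.filter (· < M)).card * (n : ℝ) ^ ε := by
        rw [Finset.prod_mul_distrib, ← Finset.prod_filter, Finset.prod_const,
          Real.finsetProd_rpow _ _ (fun _ _ => by positivity)]
        congr 2
        exact_mod_cast Nat.prod_factorization_pow_eq_self hn.ne'
    _ ≤ C ^ M * (n : ℝ) ^ ε := by
        gcongr
        simpa using Finset.card_le_card (t := Finset.range M) fun p hp =>
          Finset.mem_range.2 (Finset.mem_filter.1 hp).2

namespace AbGroupPartition

/-- The plane partition attached to a group-partition and a prime `p`. -/
noncomputable def rank (P : AbGroupPartition) (p j i : ℕ) : ℕ :=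
  if h : j < P.len then socleRank p i (P.factor ⟨j, h⟩) else 0

theorem rank_eq (P : AbGroupPartition) (p i : ℕ) (j : Fin P.len) :
    P.rank p j i = socleRank p i (P.factor j) :=
  dif_pos j.2

theorem rank_eq_zero (P : AbGroupPartition) (p i : ℕ) {j : ℕ} (h : P.len ≤ j) :
    P.rank p j i = 0 :=
  dif_neg h.not_gt

section

variable {p : ℕ} [Fact p.Prime]

theorem rank_antitone_left (P : AbGroupPartition) (i : ℕ) :
    Antitone fun j => P.rank p j i := by
  refine antitone_nat_of_succ_le fun j => ?_
  by_cases h : j + 1 < P.len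
  · obtain ⟨f, hf⟩ := P.mono j h
    simp only [rank, dif_pos h, dif_pos (Nat.lt_of_succ_lt h)]
    exact socleRank_le_of_injective f hf i
  · exact (P.rank_eq_zero p i (not_lt.1 h)).trans_le (Nat.zero_le _)

theorem rank_antitone_right (P : AbGroupPartition) (j : ℕ) :
    Antitone fun i => P.rank p j i := by
  by_cases h : j < P.len
  · simp only [rank, dif_pos h]
    exact socleRank_antitone
  · simp only [rank, dif_neg h]
    exact antitone_const

theorem padicValNat_card_factor_le {n : ℕ} (hn : 0 < n) (P : AbGroupPartition)
    (hP : ∏ j, Nat.card (P.factor j) = n) (j : Fin P.len) :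
    padicValNat p (Nat.card (P.factor j)) ≤ n.factorization p := by
  rw [Nat.factorization_def n Fact.out]
  exact padicValNat_le_of_dvd hn.ne' (hP ▸ Finset.dvd_prod_of_mem _ (Finset.mem_univ j))

theorem rank_eq_zero_of_factorization_le {n : ℕ} (hn : 0 < n) (P : AbGroupPartition)
    (hP : ∏ j, Nat.card (P.factor j) = n) (j : ℕ) {i : ℕ} (hi : n.factorization p ≤ i) :
    P.rank p j i = 0 := by
  by_cases h : j < P.len
  · rw [rank, dif_pos h]
    exact socleRank_eq_zero ((padicValNat_card_factor_le hn P hP _).trans hi)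
  · exact P.rank_eq_zero p i (not_lt.1 h)

theorem sum_rank {n : ℕ} (hn : 0 < n) (P : AbGroupPartition)
    (hP : ∏ j, Nat.card (P.factor j) = n) :
    ∑ j ∈ Finset.range P.len, ∑ i ∈ Finset.range (n.factorization p),
    P.rank p j i = n.factorization p := by
  have hprod : ∀ s : Finset (Fin P.len), padicValNat p (∏ j ∈ s, Nat.card (P.factor j)) =
      ∑ j ∈ s, padicValNat p (Nat.card (P.factor j)) := by
    intro s
    induction s using Finset.induction_on with
    | empty => simp
    | insert a s ha ih =>
      rw [Finset.prod_insert ha, Finset.sum_insert ha, padicValNat.mul Nat.card_pos.ne'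
        (Finset.prod_ne_zero_iff.2 fun i _ => Nat.card_pos.ne'), ih]
  have h : n.factorization p = ∑ j, padicValNat p (Nat.card (P.factor j)) := by
    rw [Nat.factorization_def n Fact.out, ← hP, hprod]
  rw [Finset.sum_range]
  refine (Finset.sum_congr rfl fun j _ => ?_).trans h.symm
  simp only [rank_eq]
  exact sum_socleRank (padicValNat_card_factor_le hn P hP j)

theorem rank_le {n : ℕ} (hn : 0 < n) (P : AbGroupPartition)
    (hP : ∏ j, Nat.card (P.factor j) = n) (j i : ℕ) : P.rank p j i ≤ n.factorization p := by
  by_cases hj : j < P.len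
  · by_cases hi : i < n.factorization p
    · calc P.rank p j i ≤ ∑ i ∈ Finset.range (n.factorization p), P.rank p j i :=
            Finset.single_le_sum (f := fun i => P.rank p j i) (fun _ _ => Nat.zero_le _)
              (Finset.mem_range.2 hi)
        _ ≤ ∑ j ∈ Finset.range P.len, ∑ i ∈ Finset.range (n.factorization p), P.rank p j i :=
            Finset.single_le_sum
              (f := fun j => ∑ i ∈ Finset.range (n.factorization p), P.rank p j i)
              (fun _ _ => Nat.zero_le _) (Finset.mem_range.2 hj)
        _ = n.factorization p := sum_rank hn P hP
    · rw [rank_eq_zero_of_factorization_le hn P hP j (not_lt.1 hi)]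
      exact Nat.zero_le _
  · rw [P.rank_eq_zero p i (not_lt.1 hj)]
    exact Nat.zero_le _

theorem exists_solidDiagram {n : ℕ} (hn : 0 < n) (P : AbGroupPartition)
    (hP : ∏ j, Nat.card (P.factor j) = n) :
    ∃ D : SolidDiagram (n.factorization p),
    ∀ j i l, (j, i, l) ∈ D.1 ↔ l < P.rank p j i := by
  set V := n.factorization p with hV
  let D := (Finset.range P.len ×ˢ Finset.range V ×ˢ Finset.range V).filter
    fun x => x.2.2 < P.rank p x.1 x.2.1
  have hmem : ∀ j i l, (j, i, l) ∈ D ↔ l < P.rank p j i := by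
    intro j i l
    simp only [D, Finset.mem_filter, Finset.mem_product, Finset.mem_range, and_iff_right_iff_imp]
    intro h
    refine ⟨?_, ?_, h.trans_le (rank_le hn P hP j i)⟩
    · by_contra hj
      rw [P.rank_eq_zero p i (not_lt.1 hj)] at h
      omega
    · by_contra hi
      rw [rank_eq_zero_of_factorization_le hn P hP j (not_lt.1 hi)] at h
      omega
  refine ⟨⟨D, ?_, ?_⟩, hmem⟩
  · rintro ⟨j, i, l⟩ ⟨j', i', l'⟩ ⟨hj, hi, hl⟩ h
    rw [Finset.mem_coe, hmem] at h ⊢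
    exact (hl.trans_lt h).trans_le
      ((P.rank_antitone_left i hj).trans (P.rank_antitone_right j' hi))
  · rw [Finset.card_filter, Finset.sum_product]
    refine (Finset.sum_congr rfl fun j _ => ?_).trans (sum_rank (p := p) hn P hP)
    rw [Finset.sum_product]
    refine Finset.sum_congr rfl fun i _ => ?_
    rw [← Finset.card_filter]
    have : (Finset.range V).filter (fun l => l < P.rank p j i) = Finset.range (P.rank p j i) := by
      ext l
      have := rank_le (p := p) hn P hP j i
      simp only [Finset.mem_filter, Finset.mem_range]
      omega
    rw [this, Finset.card_range]

end

theorem Equiv.rank_eq {P Q : AbGroupPartition} (h : P.Equiv Q) {p : ℕ} (hp : p.Prime) (j i : ℕ) :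
    P.rank p j i = Q.rank p j i := by
  have : Fact p.Prime := ⟨hp⟩
  obtain ⟨hlen, e⟩ := h
  by_cases hj : j < P.len
  · rw [rank, rank, dif_pos hj, dif_pos (hlen ▸ hj)]
    exact socleRank_congr (e ⟨j, hj⟩).some i
  · rw [P.rank_eq_zero p i (not_lt.1 hj), Q.rank_eq_zero p i (hlen ▸ not_lt.1 hj)]

theorem len_le_of_rank_eq {P Q : AbGroupPartition}
    (h : ∀ p : ℕ, p.Prime → ∀ j i, P.rank p j i = Q.rank p j i) : P.len ≤ Q.len := by
  by_contra! hlt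
  have := P.nontriv ⟨Q.len, hlt⟩
  obtain ⟨p, hp, hdvd⟩ := Nat.exists_prime_and_dvd
    (Finite.one_lt_card (α := P.factor ⟨Q.len, hlt⟩)).ne'
  have : Fact p.Prime := ⟨hp⟩
  have h0 : nsmulVal p 0 (P.factor ⟨Q.len, hlt⟩) ≠ 0 := by
    rw [nsmulVal_zero]
    have := one_le_padicValNat_of_dvd Nat.card_pos.ne' hdvd
    omega
  have hpos := socleRank_pos h0
  have := h p hp Q.len 0
  rw [Q.rank_eq_zero p 0 le_rfl, rank, dif_pos hlt] at this
  omega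

theorem equiv_of_rank_eq {P Q : AbGroupPartition}
    (h : ∀ p : ℕ, p.Prime → ∀ j i, P.rank p j i = Q.rank p j i) : P.Equiv Q := by
  have hlen := (len_le_of_rank_eq h).antisymm
    (len_le_of_rank_eq fun p hp j i => (h p hp j i).symm)
  refine ⟨hlen, fun j => nonempty_addEquiv_of_socleRank_eq fun p hp i => ?_⟩
  rw [← rank_eq, ← rank_eq, h p hp]
  rfl

/-- The solid diagram of a group-partition of order `n` at a prime divisor `p` of `n`. -/
noncomputable def solidDiagram {n : ℕ} (hn : 0 < n) (P : AbGroupPartition)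
    (hP : ∏ j, Nat.card (P.factor j) = n) (p : n.primeFactors) :
    SolidDiagram (n.factorization p) :=
  have : Fact (p : ℕ).Prime := ⟨Nat.prime_of_mem_primeFactors p.2⟩
  (exists_solidDiagram (p := p) hn P hP).choose

theorem mem_solidDiagram {n : ℕ} (hn : 0 < n) (P : AbGroupPartition)
    (hP : ∏ j, Nat.card (P.factor j) = n) (p : n.primeFactors) (j i l : ℕ) :
    (j, i, l) ∈ (solidDiagram hn P hP p).1 ↔ l < P.rank p j i :=
  have : Fact (p : ℕ).Prime := ⟨Nat.prime_of_mem_primeFactors p.2⟩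
  (exists_solidDiagram (p := p) hn P hP).choose_spec j i l

theorem solidDiagram_eq_iff {n : ℕ} (hn : 0 < n) {P Q : AbGroupPartition}
    (hP : ∏ j, Nat.card (P.factor j) = n) (hQ : ∏ j, Nat.card (Q.factor j) = n) :
    solidDiagram hn P hP = solidDiagram hn Q hQ ↔ P.Equiv Q := by
  constructor
  · intro h
    refine equiv_of_rank_eq fun p hp j i => ?_
    have : Fact p.Prime := ⟨hp⟩
    by_cases hpn : p ∈ n.primeFactors
    · have hlt : ∀ l, l < P.rank p j i ↔ l < Q.rank p j i := fun l => by
        rw [← mem_solidDiagram hn P hP ⟨p, hpn⟩, h, mem_solidDiagram hn Q hQ ⟨p, hpn⟩]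
      exact eq_of_forall_lt_iff hlt
    · have hv : n.factorization p = 0 := by
        rwa [← Finsupp.notMem_support_iff, Nat.support_factorization]
      rw [rank_eq_zero_of_factorization_le hn P hP j (by omega),
        rank_eq_zero_of_factorization_le hn Q hQ j (by omega)]
  · intro h
    funext p
    refine Subtype.ext (Finset.ext fun ⟨j, i, l⟩ => ?_)
    rw [mem_solidDiagram, mem_solidDiagram, h.rank_eq (Nat.prime_of_mem_primeFactors p.2)]

/-- The group-partitions of order `n` with at most `r` factors, up to isomorphism. -/
abbrev Classes (r : ℕ∞) (n : ℕ) : Type 1 :=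
  Quot fun P Q : {P : AbGroupPartition //
    (∏ j, Nat.card (P.factor j)) = n ∧ (P.len : ℕ∞) ≤ r} => P.1.Equiv Q.1

/-- The solid diagrams of an isomorphism class of group-partitions. -/
noncomputable def Classes.solidDiagram {r : ℕ∞} {n : ℕ} (hn : 0 < n) :
    Classes r n → ∀ p : n.primeFactors, SolidDiagram (n.factorization p) :=
  Quot.lift (fun P => AbGroupPartition.solidDiagram hn P.1 P.2.1)
    fun P Q h => (solidDiagram_eq_iff hn P.2.1 Q.2.1).2 h

theorem Classes.solidDiagram_injective {r : ℕ∞} {n : ℕ} (hn : 0 < n) :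
    Function.Injective (Classes.solidDiagram (r := r) hn) := by
  rintro ⟨P⟩ ⟨Q⟩ h
  exact Quot.sound ((solidDiagram_eq_iff hn P.2.1 Q.2.1).1 h)

theorem Classes.finite {r : ℕ∞} {n : ℕ} (hn : 0 < n) : Finite (Classes r n) :=
  Finite.of_injective _ (Classes.solidDiagram_injective hn)

/-- Forgetting the bound on the number of factors. -/
def Classes.toTop {r : ℕ∞} {n : ℕ} : Classes r n → Classes ⊤ n :=
  Quot.map (fun P => ⟨P.1, P.2.1, le_top⟩) fun _ _ h => h

theorem Classes.toTop_injective {r : ℕ∞} {n : ℕ} (hn : 0 < n) :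
    Function.Injective (Classes.toTop (r := r) (n := n)) := by
  rintro ⟨P⟩ ⟨Q⟩ h
  exact Quot.sound ((solidDiagram_eq_iff hn P.2.1 Q.2.1).1
    (congrArg (Classes.solidDiagram hn) h))

end AbGroupPartition

/-- For every `ε > 0` there is `D_ε > 0` with `a_r(n) ≤ a_∞(n) ≤ D_ε · n^ε` for all
positive integers `n` and all `r` (a positive integer or `∞`). -/
theorem abelianCount_le_rpow (ε : ℝ) (hε : 0 < ε) :
    ∃ D : ℝ, 0 < D ∧ ∀ n : ℕ, 0 < n →
      (∀ r : ℕ∞, r ≠ 0 → abelianCount r n ≤ abelianCount ⊤ n) ∧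
      (abelianCount ⊤ n : ℝ) ≤ D * (n : ℝ) ^ ε := by
  obtain ⟨D, hD, h⟩ := exists_prod_card_solidDiagram_le hε
  refine ⟨D, hD, fun n hn => ⟨fun r _ => ?_, le_trans ?_ (h n hn)⟩⟩
  · have := AbGroupPartition.Classes.finite (r := ⊤) hn
    exact Nat.card_le_card_of_injective _ (AbGroupPartition.Classes.toTop_injective (r := r) hn)
  · have := Nat.card_le_card_of_injective _
      (AbGroupPartition.Classes.solidDiagram_injective (r := ⊤) hn)
    rw [Nat.card_pi, Finset.prod_coe_sort n.primeFactors
      fun p => Nat.card (SolidDiagram (n.factorization p))] at this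
    exact_mod_cast this
end

section
/- There exists a constant C > 0 such that for all positive integers n, the number PL_∞(n) of all plane partitions of n satisfies PL_∞(n) ≤ exp(C · n^{2/3}). -/
open scoped ENat

/-- A plane partition of `n`: a doubly indexed family of nonnegative integers, weakly
decreasing along each row and column, with finite support and total sum `n`. -/
structure PlanePartition (n : ℕ) where
  part : ℕ → ℕ → ℕ
  decr_row : ∀ j k, part j (k + 1) ≤ part j k
  decr_col : ∀ j k, part (j + 1) k ≤ part j k
  finite : (Function.support fun x : ℕ × ℕ => part x.1 x.2).Finite
  sum_eq : ∑ᶠ (j : ℕ) (k : ℕ), part j k = n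

/-- `PL_r(n)`: the number of plane partitions of `n` with at most `r` nonzero rows
(rows are indexed from `0`, so "at most `r` nonzero rows" means row `j` vanishes
whenever `r ≤ j`); `r = ⊤` counts all plane partitions. -/
noncomputable def planePartitionCount (r : ℕ∞) (n : ℕ) : ℕ :=
  Nat.card {P : PlanePartition n // ∀ j : ℕ, r ≤ (j : ℕ∞) → ∀ k, P.part j k = 0}

namespace PlanePartition

lemma sum_range_le {n : ℕ} (P : PlanePartition n) (a b : ℕ) :
    ∑ j ∈ Finset.range a, ∑ k ∈ Finset.range b, P.part j k ≤ n := by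
  have h := P.sum_eq
  rw [← finsum_curry (fun x : ℕ × ℕ => P.part x.1 x.2) P.finite,
    finsum_eq_sum _ P.finite] at h
  rw [← Finset.sum_product' (f := fun j k => P.part j k)]
  refine (Finset.sum_le_sum_of_ne_zero fun x _ hx => ?_).trans h.le
  simpa using hx

lemma antitone_row {n : ℕ} (P : PlanePartition n) (j : ℕ) : Antitone (P.part j) :=
  antitone_nat_of_succ_le (P.decr_row j)

lemma antitone_col {n : ℕ} (P : PlanePartition n) (k : ℕ) : Antitone fun j => P.part j k :=
  antitone_nat_of_succ_le fun j => P.decr_col j k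

lemma box_le {n : ℕ} (P : PlanePartition n) (j k : ℕ) :
    (j + 1) * ((k + 1) * P.part j k) ≤ n := by
  refine le_trans ?_ (P.sum_range_le (j + 1) (k + 1))
  have h : ∀ i ∈ Finset.range (j + 1), (k + 1) * P.part j k ≤
      ∑ l ∈ Finset.range (k + 1), P.part i l := by
    intro i hi
    have h' : ∀ l ∈ Finset.range (k + 1), P.part j k ≤ P.part i l := fun l hl =>
      (P.antitone_row j (by grind : l ≤ k)).trans (P.antitone_col l (by grind : i ≤ j))
    simpa using Finset.card_nsmul_le_sum _ _ _ h'
  simpa using Finset.card_nsmul_le_sum _ _ _ h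

lemma part_eq_zero_of_le_row {n : ℕ} (P : PlanePartition n) {j : ℕ} (hj : n ≤ j) (k : ℕ) :
    P.part j k = 0 := by
  by_contra h
  have h1 := P.box_le j k
  have h2 : 1 ≤ (k + 1) * P.part j k := Nat.mul_pos (by omega) (by omega)
  nlinarith

lemma part_eq_zero_of_le_col {n : ℕ} (P : PlanePartition n) (j : ℕ) {k : ℕ} (hk : n ≤ k) :
    P.part j k = 0 := by
  by_contra h
  have h1 := P.box_le j k
  have h2 : 1 ≤ P.part j k := by omega
  have h3 : k + 1 ≤ (k + 1) * P.part j k := Nat.le_mul_of_pos_right _ h2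
  nlinarith

/-- The length of the `j`-th row of the set of positions whose entry exceeds `h`. -/
def layer {n : ℕ} (P : PlanePartition n) (h j : ℕ) : ℕ :=
  ((Finset.range n).filter fun k => h < P.part j k).card

lemma lt_layer_iff {n : ℕ} (P : PlanePartition n) (h j k : ℕ) :
    k < P.layer h j ↔ h < P.part j k := by
  constructor
  · intro hk
    by_contra hh
    refine hk.not_ge ?_
    refine (Finset.card_le_card (t := Finset.range k) fun l hl => ?_).trans_eq
      (Finset.card_range k)
    simp only [Finset.mem_filter, Finset.mem_range] at hl ⊢
    by_contra hlk
    have := P.antitone_row j (not_lt.1 hlk)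
    omega
  · intro hh
    refine Nat.lt_of_succ_le ((Finset.card_range (k + 1)).symm.trans_le
      (Finset.card_le_card fun l hl => ?_))
    have hkn : k < n := by
      by_contra hkn
      have := P.part_eq_zero_of_le_col j (not_lt.1 hkn)
      omega
    have hlk : l ≤ k := by grind
    have := P.antitone_row j hlk
    simp only [Finset.mem_filter, Finset.mem_range]
    omega

lemma layer_succ_le {n : ℕ} (P : PlanePartition n) (h j : ℕ) :
    P.layer h (j + 1) ≤ P.layer h j := by
  refine Finset.card_le_card fun k hk => ?_
  have := P.decr_col j k
  simp only [Finset.mem_filter] at hk ⊢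
  exact ⟨hk.1, hk.2.trans_le this⟩

lemma layer_eq_zero {n : ℕ} (P : PlanePartition n) (h : ℕ) : P.layer h n = 0 := by
  simp [layer, P.part_eq_zero_of_le_row le_rfl]

lemma sum_layer_le {n : ℕ} (P : PlanePartition n) (m : ℕ) :
    ∑ h ∈ Finset.range m, ∑ j ∈ Finset.range n, P.layer h j ≤ n := by
  refine le_trans ?_ (P.sum_range_le n n)
  rw [Finset.sum_comm]
  refine Finset.sum_le_sum fun j _ => ?_
  simp only [layer, Finset.card_filter]
  rw [Finset.sum_comm]
  refine Finset.sum_le_sum fun k _ => ?_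
  rw [← Finset.card_filter]
  refine (Finset.card_le_card (t := Finset.range (P.part j k)) fun h hh => ?_).trans_eq
    (Finset.card_range _)
  simpa using (Finset.mem_filter.1 hh).2

lemma ext_part {n : ℕ} {P Q : PlanePartition n} (h : ∀ j k, P.part j k = Q.part j k) :
    P = Q := by
  have h' : P.part = Q.part := funext fun j => funext (h j)
  cases P
  cases Q
  simpa using h'

lemma part_le_of_lt_cube {n m : ℕ} (hn : n < (m + 1) ^ 3) (P : PlanePartition n) {j k : ℕ}
    (hj : m ≤ j) (hk : m ≤ k) : P.part j k ≤ m := by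
  by_contra h
  have : (m + 1) * ((m + 1) * (m + 1)) ≤ n := le_trans (by gcongr; omega) (P.box_le j k)
  nlinarith

/-- A plane partition of `n < (m + 1) ^ 3` is determined by its first `m` slices in each of the
three coordinate directions. -/
lemma eq_of_slices {n m : ℕ} (hn : n < (m + 1) ^ 3) {P Q : PlanePartition n}
    (hrow : ∀ s < m, ∀ i < n, P.part s i = Q.part s i)
    (hcol : ∀ s < m, ∀ i < n, P.part i s = Q.part i s)
    (hlayer : ∀ s < m, ∀ i < n, P.layer s i = Q.layer s i) : P = Q := by
  refine ext_part fun j k => ?_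
  by_cases hjn : n ≤ j
  · rw [P.part_eq_zero_of_le_row hjn, Q.part_eq_zero_of_le_row hjn]
  by_cases hkn : n ≤ k
  · rw [P.part_eq_zero_of_le_col j hkn, Q.part_eq_zero_of_le_col j hkn]
  by_cases hj : j < m
  · exact hrow j hj k (by omega)
  by_cases hk : k < m
  · exact hcol k hk j (by omega)
  have hP := P.part_le_of_lt_cube hn (not_lt.1 hj) (not_lt.1 hk)
  have hQ := Q.part_le_of_lt_cube hn (not_lt.1 hj) (not_lt.1 hk)
  have key : ∀ h < m, (h < P.part j k ↔ h < Q.part j k) := fun h hh => by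
    rw [← lt_layer_iff, ← lt_layer_iff, hlayer h hh j (by omega)]
  rcases lt_trichotomy (P.part j k) (Q.part j k) with h | h | h
  · have := key _ (h.trans_le hQ)
    omega
  · exact h
  · have := key _ (h.trans_le hP)
    omega

end PlanePartition

/-- Families of `m` partitions of total size at most `n`, encoded by multiplicities: `d (s, i)` is
the number of parts equal to `i + 1` in the `s`-th partition. -/
def partitionFamilies (m n : ℕ) : Finset (Fin m × Fin n → ℕ) :=
  (Fintype.piFinset fun _ => Finset.range (n + 1)).filter fun d =>
    ∑ p, ((p.2 : ℕ) + 1) * d p ≤ n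

/-- The successive differences of the first `m` rows of `A`. -/
def rowDifferences (m n : ℕ) (A : ℕ → ℕ → ℕ) : Fin m × Fin n → ℕ :=
  fun p => A p.1 p.2 - A p.1 (p.2 + 1)

lemma sum_range_succ_mul_sub {f : ℕ → ℕ} (hf : ∀ i, f (i + 1) ≤ f i) (n : ℕ) :
    ∑ i ∈ Finset.range n, (i + 1) * (f i - f (i + 1)) + n * f n = ∑ i ∈ Finset.range n, f i := by
  induction n with
  | zero => simp
  | succ n ih =>
    obtain ⟨c, hc⟩ := Nat.exists_eq_add_of_le (hf n)
    rw [Finset.sum_range_succ, Finset.sum_range_succ, ← ih, hc, Nat.add_sub_cancel_left]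
    ring

lemma rowDifferences_mem {m n : ℕ} {A : ℕ → ℕ → ℕ} (hA : ∀ s i, A s (i + 1) ≤ A s i)
    (h0 : ∀ s, A s n = 0)
    (hsum : ∑ s ∈ Finset.range m, ∑ i ∈ Finset.range n, A s i ≤ n) :
    rowDifferences m n A ∈ partitionFamilies m n := by
  have hw : ∑ p, ((p.2 : ℕ) + 1) * rowDifferences m n A p ≤ n := by
    refine le_trans (le_of_eq ?_) hsum
    rw [Fintype.sum_prod_type, Finset.sum_range]
    refine Finset.sum_congr rfl fun s _ => ?_
    rw [← sum_range_succ_mul_sub (hA s), h0, mul_zero, add_zero, Finset.sum_range]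
    rfl
  refine Finset.mem_filter.2 ⟨Fintype.mem_piFinset.2 fun p => ?_, hw⟩
  have h1 := Finset.single_le_sum
    (f := fun p : Fin m × Fin n => ((p.2 : ℕ) + 1) * rowDifferences m n A p)
    (fun _ _ => Nat.zero_le _) (Finset.mem_univ p)
  have h2 : rowDifferences m n A p ≤ ((p.2 : ℕ) + 1) * rowDifferences m n A p :=
    Nat.le_mul_of_pos_left _ (by omega)
  rw [Finset.mem_range]
  have h3 := h1.trans hw
  omega

lemma eq_of_rowDifferences_eq {m n : ℕ} {A B : ℕ → ℕ → ℕ} (hA : ∀ s i, A s (i + 1) ≤ A s i)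
    (hB : ∀ s i, B s (i + 1) ≤ B s i) (hA0 : ∀ s, A s n = 0) (hB0 : ∀ s, B s n = 0)
    (h : rowDifferences m n A = rowDifferences m n B) :
    ∀ s < m, ∀ i < n, A s i = B s i := by
  intro s hs i hi
  refine Nat.decreasingInduction' (P := fun i => A s i = B s i) (fun k hk _ ih => ?_) hi.le
    ((hA0 s).trans (hB0 s).symm)
  have h1 : A s k - A s (k + 1) = B s k - B s (k + 1) := congrFun h (⟨s, hs⟩, ⟨k, hk⟩)
  have := hA s k
  have := hB s k
  omega

lemma sum_neg_log_one_sub_pow_le {m : ℕ} (hm : 0 < m) (n : ℕ) :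
    ∑ i ∈ Finset.range n, -Real.log (1 - ((1 + 1 / (m : ℝ))⁻¹) ^ (i + 1)) ≤
      m * ∑' k : ℕ, 1 / ((k : ℝ) + 1) ^ 2 := by
  have hm' : (0 : ℝ) < 1 / m := by positivity
  set x : ℝ := (1 + 1 / (m : ℝ))⁻¹ with hx
  have hx0 : 0 < x := by positivity
  have hx1 : x < 1 := inv_lt_one_of_one_lt₀ (by linarith)
  have hS : Summable fun k : ℕ => 1 / ((k : ℝ) + 1) ^ 2 := by
    have := (summable_nat_add_iff 1).2 (Real.summable_one_div_nat_pow.2 one_lt_two)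
    simpa using this
  have hL : HasSum (fun k : ℕ => ∑ i ∈ Finset.range n, (x ^ (i + 1)) ^ (k + 1) / ((k : ℝ) + 1))
      (∑ i ∈ Finset.range n, -Real.log (1 - x ^ (i + 1))) := by
    refine hasSum_sum fun i _ => Real.hasSum_pow_div_log_of_abs_lt_one ?_
    rw [abs_of_pos (by positivity)]
    exact pow_lt_one₀ hx0.le hx1 (by omega)
  refine hasSum_le (fun k => ?_) hL (hS.hasSum.mul_left (m : ℝ))
  have hk : (0 : ℝ) < (k : ℝ) + 1 := by positivity
  have hy0 : 0 < x ^ (k + 1) := by positivity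
  have hy1 : x ^ (k + 1) < 1 := pow_lt_one₀ hx0.le hx1 (by omega)
  have hgeom : ∑ i ∈ Finset.range n, (x ^ (i + 1)) ^ (k + 1) ≤
      x ^ (k + 1) * (1 - x ^ (k + 1))⁻¹ := by
    have h1 := (summable_geometric_of_lt_one hy0.le hy1).sum_le_tsum (Finset.range n)
      (fun i _ => by positivity)
    rw [tsum_geometric_of_lt_one hy0.le hy1] at h1
    calc _ = x ^ (k + 1) * ∑ i ∈ Finset.range n, (x ^ (k + 1)) ^ i := by
          rw [Finset.mul_sum]
          exact Finset.sum_congr rfl fun i _ => by ring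
      _ ≤ _ := by gcongr
  have hbern : ((k : ℝ) + 1) / m ≤ (x ^ (k + 1))⁻¹ - 1 := by
    have h1 := one_add_mul_le_pow (by linarith : (-2 : ℝ) ≤ 1 / m) (k + 1)
    rw [← inv_pow, hx, inv_inv]
    push_cast at h1
    rw [mul_one_div] at h1
    linarith
  have hfrac : x ^ (k + 1) * (1 - x ^ (k + 1))⁻¹ ≤ m / ((k : ℝ) + 1) := by
    have h1 : x ^ (k + 1) * (1 - x ^ (k + 1))⁻¹ = ((x ^ (k + 1))⁻¹ - 1)⁻¹ := by
      have : 1 - x ^ (k + 1) ≠ 0 := by linarith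
      field_simp
    rw [h1, ← inv_div]
    exact inv_anti₀ (by positivity) hbern
  rw [← Finset.sum_div]
  calc _ ≤ (m / ((k : ℝ) + 1)) / ((k : ℝ) + 1) := by
        gcongr
        exact hgeom.trans hfrac
    _ = _ := by field_simp

lemma card_partitionFamilies_le {m : ℕ} (hm : 0 < m) (n : ℕ) :
    ((partitionFamilies m n).card : ℝ) ≤
      Real.exp (n / m + m * (m * ∑' k : ℕ, 1 / ((k : ℝ) + 1) ^ 2)) := by
  have hm' : (0 : ℝ) < 1 / m := by positivity
  have hlog := sum_neg_log_one_sub_pow_le hm n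
  set x : ℝ := (1 + 1 / (m : ℝ))⁻¹ with hx
  have hx0 : 0 < x := by positivity
  have hx1 : x < 1 := inv_lt_one_of_one_lt₀ (by linarith)
  have hlt : ∀ i : ℕ, x ^ (i + 1) < 1 := fun i => pow_lt_one₀ hx0.le hx1 (by omega)
  have h1 : ((partitionFamilies m n).card : ℝ) * x ^ n ≤
      ∏ p : Fin m × Fin n, ∑ v ∈ Finset.range (n + 1), (x ^ ((p.2 : ℕ) + 1)) ^ v := by
    rw [Finset.prod_univ_sum, ← nsmul_eq_mul]
    have hd : ∀ d ∈ partitionFamilies m n, x ^ n ≤ ∏ p, (x ^ ((p.2 : ℕ) + 1)) ^ d p := by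
      intro d hd
      simp only [← pow_mul, Finset.prod_pow_eq_pow_sum]
      exact pow_le_pow_of_le_one hx0.le hx1.le (Finset.mem_filter.1 hd).2
    refine (Finset.card_nsmul_le_sum _ _ _ hd).trans ?_
    exact Finset.sum_le_sum_of_subset_of_nonneg (Finset.filter_subset _ _)
      fun d _ _ => Finset.prod_nonneg fun p _ => by positivity
  have h2 : ∏ p : Fin m × Fin n, ∑ v ∈ Finset.range (n + 1), (x ^ ((p.2 : ℕ) + 1)) ^ v ≤
      Real.exp (m * (m * ∑' k : ℕ, 1 / ((k : ℝ) + 1) ^ 2)) := by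
    calc _ ≤ ∏ p : Fin m × Fin n, Real.exp (-Real.log (1 - x ^ ((p.2 : ℕ) + 1))) := by
          refine Finset.prod_le_prod (fun _ _ => by positivity) fun p _ => ?_
          rw [Real.exp_neg, Real.exp_log (by linarith [hlt p.2]),
            ← tsum_geometric_of_lt_one (by positivity) (hlt p.2)]
          exact (summable_geometric_of_lt_one (by positivity) (hlt p.2)).sum_le_tsum _
            fun i _ => by positivity
      _ = Real.exp (m * ∑ i ∈ Finset.range n, -Real.log (1 - x ^ (i + 1))) := by
          rw [← Real.exp_sum, Fintype.sum_prod_type, Finset.sum_range]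
          simp
      _ ≤ _ := by gcongr
  have h3 : (x ^ n)⁻¹ ≤ Real.exp (n / m) := by
    rw [← inv_pow, hx, inv_inv, div_eq_mul_one_div (n : ℝ), Real.exp_nat_mul]
    gcongr
    linarith [Real.add_one_le_exp (1 / (m : ℝ))]
  rw [Real.exp_add]
  calc _ ≤ (x ^ n)⁻¹ * Real.exp (m * (m * ∑' k : ℕ, 1 / ((k : ℝ) + 1) ^ 2)) := by
        rw [inv_mul_eq_div, le_div_iff₀ (by positivity)]
        exact h1.trans h2
    _ ≤ _ := by gcongr

lemma planePartitionCount_le_card_pow {n m : ℕ} (hn : n < (m + 1) ^ 3) (r : ℕ∞) :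
    planePartitionCount r n ≤ (partitionFamilies m n).card ^ 3 := by
  let T := partitionFamilies m n
  let e : {P : PlanePartition n // ∀ j : ℕ, r ≤ (j : ℕ∞) → ∀ k, P.part j k = 0} → T × T × T :=
    fun P =>
      (⟨_, rowDifferences_mem (A := P.1.part) P.1.decr_row
          (fun s => P.1.part_eq_zero_of_le_col s le_rfl) (P.1.sum_range_le m n)⟩,
        ⟨_, rowDifferences_mem (A := fun k j => P.1.part j k) (fun k j => P.1.decr_col j k)
          (P.1.part_eq_zero_of_le_row le_rfl)
          (by rw [Finset.sum_comm]; exact P.1.sum_range_le n m)⟩,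
        ⟨_, rowDifferences_mem (A := P.1.layer) P.1.layer_succ_le P.1.layer_eq_zero
          (P.1.sum_layer_le m)⟩)
  have he : Function.Injective e := by
    intro P Q h
    simp only [e, Prod.mk.injEq, Subtype.mk.injEq] at h
    obtain ⟨h1, h2, h3⟩ := h
    refine Subtype.ext (PlanePartition.eq_of_slices hn ?_ ?_ ?_)
    · exact eq_of_rowDifferences_eq P.1.decr_row Q.1.decr_row
        (fun s => P.1.part_eq_zero_of_le_col s le_rfl)
        (fun s => Q.1.part_eq_zero_of_le_col s le_rfl) h1
    · exact eq_of_rowDifferences_eq (fun k j => P.1.decr_col j k) (fun k j => Q.1.decr_col j k)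
        (P.1.part_eq_zero_of_le_row le_rfl) (Q.1.part_eq_zero_of_le_row le_rfl) h2
    · exact eq_of_rowDifferences_eq P.1.layer_succ_le Q.1.layer_succ_le
        P.1.layer_eq_zero Q.1.layer_eq_zero h3
  refine (Nat.card_le_card_of_injective e he).trans_eq ?_
  simp only [Nat.card_eq_fintype_card, Fintype.card_prod, Fintype.card_coe, T]
  ring

/-- There is `C > 0` with `PL_∞(n) ≤ exp(C · n^{2/3})` for all positive integers `n`. -/
theorem planePartitionCount_le_exp :
    ∃ C : ℝ, 0 < C ∧ ∀ n : ℕ, 0 < n →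
      (planePartitionCount ⊤ n : ℝ) ≤ Real.exp (C * (n : ℝ) ^ ((2 : ℝ) / 3)) := by
  set Z : ℝ := ∑' k : ℕ, 1 / ((k : ℝ) + 1) ^ 2
  have hZ0 : 0 ≤ Z := tsum_nonneg fun k => by positivity
  refine ⟨3 * (1 + 4 * Z), by positivity, fun n hn => ?_⟩
  have hn1 : (1 : ℝ) ≤ n := by exact_mod_cast hn
  set y : ℝ := (n : ℝ) ^ ((1 : ℝ) / 3) with hy
  have hy1 : 1 ≤ y := Real.one_le_rpow hn1 (by norm_num)
  have hy2 : (n : ℝ) ^ ((2 : ℝ) / 3) = y ^ 2 := by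
    rw [hy, ← Real.rpow_natCast, ← Real.rpow_mul (by positivity)]
    norm_num
  have hy3 : (n : ℝ) = y ^ 3 := by
    rw [hy, ← Real.rpow_natCast, ← Real.rpow_mul (by positivity)]
    norm_num
  set m : ℕ := ⌈y⌉₊ with hm
  have hm0 : 0 < m := Nat.ceil_pos.2 (by linarith)
  have hym : y ≤ m := Nat.le_ceil y
  have hmy : (m : ℝ) ≤ 2 * y := by
    linarith [Nat.ceil_lt_add_one (by linarith : 0 ≤ y)]
  have hcube : n < (m + 1) ^ 3 := by
    have : (n : ℝ) < ((m : ℝ) + 1) ^ 3 := by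
      rw [hy3]
      gcongr
      linarith
    exact_mod_cast this
  have hdiv : (n : ℝ) / m ≤ y ^ 2 := by
    rw [div_le_iff₀ (by positivity), hy3, pow_succ]
    gcongr
  have hsq : (m : ℝ) * (m * Z) ≤ 4 * Z * y ^ 2 := by
    calc (m : ℝ) * (m * Z) ≤ (2 * y) * ((2 * y) * Z) := by gcongr
      _ = _ := by ring
  calc (planePartitionCount ⊤ n : ℝ) ≤ ((partitionFamilies m n).card : ℝ) ^ 3 := by
        exact_mod_cast planePartitionCount_le_card_pow hcube ⊤
    _ ≤ Real.exp (n / m + m * (m * Z)) ^ 3 := by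
        exact pow_le_pow_left₀ (Nat.cast_nonneg _) (card_partitionFamilies_le hm0 n) 3
    _ = Real.exp (3 * (n / m + m * (m * Z))) := by
        rw [← Real.exp_nat_mul]
        norm_num
    _ ≤ _ := by
        rw [hy2]
        exact Real.exp_le_exp.2 (by linarith)
end
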